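/- arXiv:1506.03439 — 3 statements merged into one kernel-verified Lean document; each statement's English description precedes it below -/
import Mathlib

section
/- Let ψ be a smooth closed k-form on ℝⁿ with δ(|ψ|^{p-2}ψ) = 0, p > 1, n > kp. If ∫_{B_R(0)} |ψ|^p dx = o(R^{n−kp}) as R → ∞, then ψ ≡ 0. -/
open MeasureTheory Set Filter Asymptotics

noncomputable section

def IsAltForm7 (n k : ℕ) (ψ : (Fin k → Fin n) → ℝ) : Prop :=
  ∀ (σ : Equiv.Perm (Fin k)) (t : Fin k → Fin n),
    ψ (t ∘ σ) = (Equiv.Perm.sign σ : ℤ) * ψ t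

def ins7 {n k : ℕ} (hk : 0 < k) (i : Fin n) (j : Fin (k - 1) → Fin n) : Fin k → Fin n :=
  fun a => Fin.cons (α := fun _ => Fin n) i j (Fin.cast (Nat.succ_pred_eq_of_pos hk).symm a)

def pd7 {n : ℕ} (f : EuclideanSpace ℝ (Fin n) → ℝ) (i : Fin n)
    (x : EuclideanSpace ℝ (Fin n)) : ℝ :=
  fderiv ℝ f x (EuclideanSpace.single i 1)

def nrm7 {n k : ℕ} (ψ : EuclideanSpace ℝ (Fin n) → (Fin k → Fin n) → ℝ)
    (x : EuclideanSpace ℝ (Fin n)) : ℝ :=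
  Real.sqrt ((k.factorial : ℝ)⁻¹ * ∑ t : Fin k → Fin n, ψ x t ^ 2)

def IsClosed7 {n k : ℕ} (ψ : EuclideanSpace ℝ (Fin n) → (Fin k → Fin n) → ℝ) : Prop :=
  ∀ (x : EuclideanSpace ℝ (Fin n)) (t : Fin (k + 1) → Fin n),
    ∑ a : Fin (k + 1), (-1 : ℝ) ^ (a : ℕ) * pd7 (fun y => ψ y (t ∘ a.succAbove)) (t a) x = 0

def IsPCoclosed7 {n k : ℕ} (hk : 0 < k) (p : ℝ)
    (ψ : EuclideanSpace ℝ (Fin n) → (Fin k → Fin n) → ℝ) : Prop :=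
  ∀ (x : EuclideanSpace ℝ (Fin n)) (j : Fin (k - 1) → Fin n),
    ∑ i : Fin n, pd7 (fun y => nrm7 ψ y ^ (p - 2) * ψ y (ins7 hk i j)) i x = 0

section AbstractC1

variable {X : Type*} [NormedAddCommGroup X] [NormedSpace ℝ X] {ι : Type*} [Fintype ι]

lemma cont_aux {S P : X → ℝ} (hS : Continuous S) (hP : Continuous P) (hS0 : ∀ x, 0 ≤ S x)
    {γ m C : ℝ} (hm : 0 < m) (hγ : 0 < γ + m) (hb : ∀ x, |P x| ≤ C * S x ^ m) :
    Continuous (fun x => S x ^ γ * P x) := by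
  rw [continuous_iff_continuousAt]
  intro x
  by_cases hx : S x = 0
  · have hPz : ∀ y, S y = 0 → P y = 0 := by
      intro y hy
      have := hb y
      rw [hy, Real.zero_rpow hm.ne', mul_zero] at this
      exact abs_nonpos_iff.mp this
    have hb2 : ∀ y, ‖S y ^ γ * P y‖ ≤ C * S y ^ (γ + m) := by
      intro y
      rcases (hS0 y).eq_or_lt with h | h
      · rw [hPz y h.symm, ← h, Real.zero_rpow hγ.ne']; simp
      · rw [norm_mul, Real.norm_of_nonneg (Real.rpow_nonneg h.le _), Real.norm_eq_abs,
          Real.rpow_add h]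
        have := mul_le_mul_of_nonneg_left (hb y) (Real.rpow_nonneg h.le γ)
        linarith
    unfold ContinuousAt
    beta_reduce
    rw [hPz x hx, mul_zero]
    refine squeeze_zero_norm hb2 ?_
    have : ContinuousAt (fun y => C * S y ^ (γ + m)) x :=
      continuousAt_const.mul (hS.continuousAt.rpow_const (Or.inr hγ.le))
    unfold ContinuousAt at this
    beta_reduce at this
    rwa [hx, Real.zero_rpow hγ.ne', mul_zero] at this
  · exact (hS.continuousAt.rpow_const (Or.inl hx)).mul hP.continuousAt

lemma abs_le_aux {φ : ι → X → ℝ} {κ : ℝ} (hκ : 0 < κ) (a : ι) (x : X) :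
    |φ a x| ≤ (κ⁻¹) ^ (1/2 : ℝ) * (κ * ∑ t, φ t x ^ 2) ^ (1/2 : ℝ) := by
  have h0 : 0 ≤ ∑ t, φ t x ^ 2 := Finset.sum_nonneg fun _ _ => sq_nonneg _
  rw [← Real.mul_rpow (by positivity) (by positivity), ← mul_assoc, inv_mul_cancel₀ hκ.ne', one_mul,
    ← Real.sqrt_eq_rpow]
  apply Real.abs_le_sqrt
  exact Finset.single_le_sum (f := fun t => φ t x ^ 2) (fun _ _ => sq_nonneg _) (Finset.mem_univ a)

lemma F_hasFDerivAt {φ : ι → X → ℝ} (hφ : ∀ t, ContDiff ℝ 1 (φ t)) {κ β : ℝ} (hκ : 0 < κ)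
    (hβ : -(1/2) < β) (a b : ι) :
    ∃ F' : X → X →L[ℝ] ℝ, Continuous F' ∧
      (∀ x, HasFDerivAt (fun x => (κ * ∑ t, φ t x ^ 2) ^ β * φ a x * φ b x) (F' x) x) ∧
      ∀ x, (∀ t, φ t x = 0) → F' x = 0 := by
  set S : X → ℝ := fun x => κ * ∑ t, φ t x ^ 2 with hS
  have hφc : ∀ t, Continuous (φ t) := fun t => (hφ t).continuous
  have hSc : Continuous S := by fun_prop
  have hS0 : ∀ x, 0 ≤ S x := fun x =>
    mul_nonneg hκ.le (Finset.sum_nonneg fun _ _ => sq_nonneg _)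
  have hSz : ∀ x, S x = 0 → ∀ t, φ t x = 0 := by
    intro x hx t
    have := abs_le_aux (φ := φ) hκ t x
    change _ ≤ _ * S x ^ _ at this
    rw [hx, Real.zero_rpow (by norm_num), mul_zero] at this
    exact abs_nonpos_iff.mp this
  have c1 : ∀ a, Continuous (fun x => S x ^ β * φ a x) := fun a =>
    cont_aux hSc (hφc a) hS0 (m := 1/2) (by norm_num) (by linarith) (fun x => abs_le_aux hκ a x)
  have c3 : ∀ t, Continuous (fun x => S x ^ (β - 1) * (φ a x * φ b x * φ t x)) := by
    intro t
    refine cont_aux (C := ((κ⁻¹) ^ (1/2 : ℝ)) ^ 3) hSc (((hφc a).mul (hφc b)).mul (hφc t)) hS0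
      (m := 3/2) (by norm_num) (by linarith) ?_
    intro x
    change |φ a x * φ b x * φ t x| ≤ _
    have e : S x ^ (3/2 : ℝ) = (S x ^ (1/2 : ℝ)) ^ 3 := by
      rw [← Real.rpow_natCast, ← Real.rpow_mul (hS0 x)]; norm_num
    rw [e, ← mul_pow, abs_mul, abs_mul, pow_succ, pow_two]
    have ha := abs_le_aux (φ := φ) hκ a x
    have hb := abs_le_aux (φ := φ) hκ b x
    have ht := abs_le_aux (φ := φ) hκ t x
    gcongr
  have hD : ∀ t, Continuous (fderiv ℝ (φ t)) := fun t => (hφ t).continuous_fderiv one_ne_zero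
  refine ⟨fun x => (∑ t, (2 * κ * β * (S x ^ (β - 1) * (φ a x * φ b x * φ t x))) • fderiv ℝ (φ t) x)
    + (S x ^ β * φ a x) • fderiv ℝ (φ b) x + (S x ^ β * φ b x) • fderiv ℝ (φ a) x, ?_, ?_, ?_⟩
  · have := c1 a
    have := c1 b
    refine ((continuous_finsetSum _ fun t _ => ?_).add ?_).add ?_
    · exact (continuous_const.mul (c3 t)).smul (hD t)
    · exact (c1 a).smul (hD b)
    · exact (c1 b).smul (hD a)
  · intro x
    have hd : ∀ t, HasFDerivAt (φ t) (fderiv ℝ (φ t) x) x := fun t =>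
      ((hφ t).differentiable one_ne_zero x).hasFDerivAt
    by_cases hx : S x = 0
    · have hz := hSz x hx
      have e0 : ((∑ t, (2 * κ * β * (S x ^ (β - 1) * (φ a x * φ b x * φ t x))) • fderiv ℝ (φ t) x)
        + (S x ^ β * φ a x) • fderiv ℝ (φ b) x + (S x ^ β * φ b x) • fderiv ℝ (φ a) x) = 0 := by
        simp [hz]
      beta_reduce
      rw [e0, hasFDerivAt_iff_isLittleO]
      have h1 : (fun y => S y ^ β * φ a y) =o[nhds x] (fun _ => (1 : ℝ)) := by
        rw [isLittleO_one_iff]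
        have := (c1 a).tendsto x
        simpa [hz a] using this
      have h2 : (φ b) =O[nhds x] (fun y => y - x) := by
        have := (hd b).isBigO_sub
        simpa [hz b] using this
      have h3 := h1.mul_isBigO h2.norm_right
      simp only [one_mul] at h3
      have h4 := h3.of_norm_right
      simpa [hz b] using h4
    · have hSd : HasFDerivAt S (κ • ∑ t, (2 * φ t x) • fderiv ℝ (φ t) x) x := by
        have : HasFDerivAt (fun x => ∑ t, φ t x ^ 2) (∑ t, (2 * φ t x) • fderiv ℝ (φ t) x) x := by
          apply HasFDerivAt.fun_sum
          intro t _
          simpa using (hd t).pow 2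
        exact this.const_mul κ
      have h := ((hSd.rpow_const (p := β) (Or.inl hx)).mul (hd a)).mul (hd b)
      refine h.congr_fderiv ?_
      ext v
      simp [Finset.mul_sum]
      have : ∀ t, 2 * κ * β * (S x ^ (β - 1) * (φ a x * φ b x * φ t x)) * fderiv ℝ (φ t) x v =
        φ b x * (φ a x * (β * S x ^ (β - 1) * (κ * (2 * φ t x * fderiv ℝ (φ t) x v)))) := by
        intro t; ring
      simp only [this]
      ring
  · intro x hz
    simp [hz]

end AbstractC1

section Alg

lemma alt_insertNth {n m : ℕ} {ω : (Fin (m+1) → Fin n) → ℝ} (h : IsAltForm7 n (m+1) ω)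
    (a : Fin (m+1)) (i : Fin n) (J : Fin m → Fin n) :
    ω (Fin.insertNth (α := fun _ => Fin n) a i J) =
      (-1) ^ (a : ℕ) * ω (Fin.cons (α := fun _ => Fin n) i J) := by
  have := h a.cycleRange (Fin.cons (α := fun _ => Fin n) i J)
  rw [Fin.cons_comp_cycleRange, Fin.sign_cycleRange] at this
  simpa using this

lemma sum_tuple {n m : ℕ} (a : Fin (m+1)) (f : (Fin (m+1) → Fin n) → ℝ) :
    ∑ t, f t = ∑ i : Fin n, ∑ J : Fin m → Fin n, f (Fin.insertNth (α := fun _ => Fin n) a i J) := by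
  rw [← (Fin.insertNthEquiv (fun _ => Fin n) a).sum_comp, Fintype.sum_prod_type]
  rfl

lemma sum_tuple_cons {n m : ℕ} (f : (Fin (m+1) → Fin n) → ℝ) :
    ∑ t, f t = ∑ i : Fin n, ∑ J : Fin m → Fin n, f (Fin.cons (α := fun _ => Fin n) i J) := by
  rw [sum_tuple 0]
  simp only [Fin.insertNth_zero']

/-- closedness contracted with the form -/
lemma closed_contract {n m : ℕ} {ω : (Fin (m+1) → Fin n) → ℝ} (h : IsAltForm7 n (m+1) ω)
    (D : Fin n → (Fin (m+1) → Fin n) → ℝ)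
    (hD : ∀ t : Fin (m + 2) → Fin n,
      ∑ a : Fin (m + 2), (-1 : ℝ) ^ (a : ℕ) * D (t a) (t ∘ a.succAbove) = 0) (j : Fin n) :
    ∑ t, ω t * D j t = (m + 1) * ∑ i : Fin n, ∑ J : Fin m → Fin n,
      ω (Fin.cons (α := fun _ => Fin n) i J) * D i (Fin.cons (α := fun _ => Fin n) j J) := by
  have h1 : ∀ t : Fin (m+1) → Fin n, D j t = ∑ a : Fin (m+1), (-1 : ℝ) ^ (a : ℕ) *
      D (t a) (Fin.cons (α := fun _ => Fin n) j (t ∘ a.succAbove)) := by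
    intro t
    have := hD (Fin.cons (α := fun _ => Fin n) j t)
    rw [Fin.sum_univ_succ] at this
    have e0 : (Fin.cons (α := fun _ => Fin n) j t : Fin (m+2) → Fin n) ∘ (Fin.succAbove 0) = t := by
      ext x; simp
    have e1 : ∀ a : Fin (m+1), (Fin.cons (α := fun _ => Fin n) j t : Fin (m+2) → Fin n) ∘
        (Fin.succAbove a.succ) = Fin.cons (α := fun _ => Fin n) j (t ∘ a.succAbove) := by
      intro a
      funext x
      refine Fin.cases ?_ (fun y => ?_) x
      · simp
      · simp
    simp only [e0, e1, Fin.cons_zero, Fin.cons_succ, Fin.val_succ, pow_succ] at this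
    simp at this
    linarith
  calc ∑ t, ω t * D j t = ∑ t, ∑ a : Fin (m+1), (-1 : ℝ) ^ (a : ℕ) * ω t *
      D (t a) (Fin.cons (α := fun _ => Fin n) j (t ∘ a.succAbove)) := by
        refine Finset.sum_congr rfl fun t _ => ?_
        rw [h1 t, Finset.mul_sum]
        exact Finset.sum_congr rfl fun a _ => by ring
    _ = ∑ a : Fin (m+1), ∑ i : Fin n, ∑ J : Fin m → Fin n,
      ω (Fin.cons (α := fun _ => Fin n) i J) * D i (Fin.cons (α := fun _ => Fin n) j J) := by
        rw [Finset.sum_comm]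
        refine Finset.sum_congr rfl fun a _ => ?_
        rw [sum_tuple a]
        refine Finset.sum_congr rfl fun i _ => Finset.sum_congr rfl fun J _ => ?_
        have e : (Fin.insertNth (α := fun _ => Fin n) a i J : Fin (m+1) → Fin n) ∘ a.succAbove = J := by
          ext x; simp
        rw [alt_insertNth h, e, Fin.insertNth_apply_same, ← mul_assoc, ← pow_add, ← two_mul, pow_mul]
        simp
    _ = _ := by simp

end Alg

section Stress

variable {n m : ℕ}

local notation "EE" => EuclideanSpace ℝ (Fin n)

lemma S_nonneg (ψ : EE → (Fin (m+1) → Fin n) → ℝ) (x : EE) :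
    0 ≤ (((m+1).factorial : ℝ)⁻¹ * ∑ t : Fin (m+1) → Fin n, ψ x t ^ 2) :=
  mul_nonneg (by positivity) (Finset.sum_nonneg fun _ _ => sq_nonneg _)

lemma nrm7_rpow (ψ : EE → (Fin (m+1) → Fin n) → ℝ) (x : EE) (r : ℝ) :
    nrm7 ψ x ^ r = (((m+1).factorial : ℝ)⁻¹ * ∑ t : Fin (m+1) → Fin n, ψ x t ^ 2) ^ (r / 2) := by
  unfold nrm7
  rw [Real.sqrt_eq_rpow, ← Real.rpow_mul (S_nonneg ψ x)]
  congr 1; ring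

lemma nrm7_nonneg (ψ : EE → (Fin (m+1) → Fin n) → ℝ) (x : EE) : 0 ≤ nrm7 ψ x :=
  Real.sqrt_nonneg _

lemma nrm7_sq (ψ : EE → (Fin (m+1) → Fin n) → ℝ) (x : EE) :
    nrm7 ψ x ^ 2 = (((m+1).factorial : ℝ)⁻¹ * ∑ t : Fin (m+1) → Fin n, ψ x t ^ 2) :=
  Real.sq_sqrt (S_nonneg ψ x)

lemma nrm7_zero_iff (ψ : EE → (Fin (m+1) → Fin n) → ℝ) (x : EE) (h : nrm7 ψ x = 0) (t) :
    ψ x t = 0 := by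
  have h1 := nrm7_sq ψ x
  rw [h] at h1
  have h2 : ∑ t : Fin (m+1) → Fin n, ψ x t ^ 2 = 0 := by
    have : ((m+1).factorial : ℝ)⁻¹ ≠ 0 := by positivity
    have h3 : (((m+1).factorial : ℝ)⁻¹ * ∑ t : Fin (m+1) → Fin n, ψ x t ^ 2) = 0 := by
      rw [← h1]; norm_num
    exact (mul_eq_zero.mp h3).resolve_left this
  rw [Finset.sum_eq_zero_iff_of_nonneg (fun _ _ => sq_nonneg _)] at h2
  exact pow_eq_zero_iff (two_ne_zero) |>.mp (h2 t (Finset.mem_univ t))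

def FF (p : ℝ) (ψ : EE → (Fin (m+1) → Fin n) → ℝ) (a b : Fin (m+1) → Fin n) (x : EE) : ℝ :=
  nrm7 ψ x ^ (p - 2) * ψ x a * ψ x b

def TT (p : ℝ) (ψ : EE → (Fin (m+1) → Fin n) → ℝ) (i j : Fin n) (x : EE) : ℝ :=
  (if i = j then 1 / p * nrm7 ψ x ^ p else 0) - ((m.factorial : ℝ)⁻¹) * ∑ J : Fin m → Fin n,
    FF p ψ (Fin.cons (α := fun _ => Fin n) i J) (Fin.cons (α := fun _ => Fin n) j J) x

lemma FF_C1 {p : ℝ} (hp : 1 < p) {ψ : EE → (Fin (m+1) → Fin n) → ℝ}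
    (hψ : ∀ t, ContDiff ℝ 1 (fun x => ψ x t)) (a b) :
    ContDiff ℝ 1 (FF p ψ a b) ∧ ∀ x, nrm7 ψ x = 0 → fderiv ℝ (FF p ψ a b) x = 0 := by
  obtain ⟨F', h1, h2, h3⟩ := F_hasFDerivAt (φ := fun t x => ψ x t) hψ
    (κ := ((m+1).factorial : ℝ)⁻¹) (β := (p-2)/2) (by positivity) (by linarith) a b
  have e : FF p ψ a b = fun x => (((m+1).factorial : ℝ)⁻¹ * ∑ t, ψ x t ^ 2) ^ ((p-2)/2)
      * ψ x a * ψ x b := by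
    funext x
    rw [FF, nrm7_rpow]
  rw [e]
  refine ⟨contDiff_one_iff_hasFDerivAt.mpr ⟨F', h1, h2⟩, fun x hx => ?_⟩
  rw [(h2 x).fderiv]
  exact h3 x (nrm7_zero_iff ψ x hx)

lemma nrm7_pow_eq {p : ℝ} (hp : 1 < p) (ψ : EE → (Fin (m+1) → Fin n) → ℝ) (x : EE) :
    nrm7 ψ x ^ p = ((m+1).factorial : ℝ)⁻¹ * ∑ t, FF p ψ t t x := by
  have h : nrm7 ψ x ^ p = nrm7 ψ x ^ (p-2) * nrm7 ψ x ^ 2 := by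
    rcases (nrm7_nonneg ψ x).eq_or_lt with h | h
    · rw [← h, Real.zero_rpow (by linarith)]; simp
    · rw [← Real.rpow_natCast, ← Real.rpow_add h]; norm_num
  rw [h, nrm7_sq, mul_left_comm, Finset.mul_sum]
  congr 1
  exact Finset.sum_congr rfl fun t _ => by rw [FF]; ring

lemma nrm7_pow_C1 {p : ℝ} (hp : 1 < p) {ψ : EE → (Fin (m+1) → Fin n) → ℝ}
    (hψ : ∀ t, ContDiff ℝ 1 (fun x => ψ x t)) :
    ContDiff ℝ 1 (fun x => nrm7 ψ x ^ p) ∧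
      ∀ x, nrm7 ψ x = 0 → fderiv ℝ (fun x => nrm7 ψ x ^ p) x = 0 := by
  simp only [nrm7_pow_eq hp]
  have hF := fun a b => FF_C1 hp hψ a b
  refine ⟨contDiff_const.mul (ContDiff.sum fun t _ => (hF t t).1), fun x hx => ?_⟩
  have hd : HasFDerivAt (fun x => ((m+1).factorial : ℝ)⁻¹ * ∑ t, FF p ψ t t x)
      (((m+1).factorial : ℝ)⁻¹ • ∑ t, fderiv ℝ (FF p ψ t t) x) x :=
    (HasFDerivAt.fun_sum fun t _ =>
      ((hF t t).1.differentiable one_ne_zero x).hasFDerivAt).const_mul _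
  rw [hd.fderiv]
  simp [fun t => (hF t t).2 x hx]

lemma TT_C1 {p : ℝ} (hp : 1 < p) {ψ : EE → (Fin (m+1) → Fin n) → ℝ}
    (hψ : ∀ t, ContDiff ℝ 1 (fun x => ψ x t)) (i j : Fin n) : ContDiff ℝ 1 (TT p ψ i j) := by
  have h2 : ContDiff ℝ 1 (fun x => ((m.factorial : ℝ)⁻¹) * ∑ J : Fin m → Fin n,
    FF p ψ (Fin.cons (α := fun _ => Fin n) i J) (Fin.cons (α := fun _ => Fin n) j J) x) :=
    contDiff_const.mul (ContDiff.sum fun J _ => (FF_C1 hp hψ _ _).1)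
  unfold TT
  by_cases h : i = j
  · simp only [h, if_true] at h2 ⊢
    exact (contDiff_const.mul (nrm7_pow_C1 hp hψ).1).sub h2
  · simp only [h, if_false]
    exact contDiff_const.sub h2

lemma TT_fderiv {p : ℝ} (hp : 1 < p) {ψ : EE → (Fin (m+1) → Fin n) → ℝ}
    (hψ : ∀ t, ContDiff ℝ 1 (fun x => ψ x t)) (i j : Fin n) (x : EE) :
    pd7 (TT p ψ i j) i x = (if i = j then 1 / p * pd7 (fun x => nrm7 ψ x ^ p) i x else 0)
      - ((m.factorial : ℝ)⁻¹) * ∑ J : Fin m → Fin n,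
      pd7 (FF p ψ (Fin.cons (α := fun _ => Fin n) i J) (Fin.cons (α := fun _ => Fin n) j J)) i x := by
  have h1 : HasFDerivAt (fun x => nrm7 ψ x ^ p) (fderiv ℝ (fun x => nrm7 ψ x ^ p) x) x :=
    ((nrm7_pow_C1 hp hψ).1.differentiable one_ne_zero x).hasFDerivAt
  have h2 : HasFDerivAt (fun x => ((m.factorial : ℝ)⁻¹) * ∑ J : Fin m → Fin n,
    FF p ψ (Fin.cons (α := fun _ => Fin n) i J) (Fin.cons (α := fun _ => Fin n) j J) x)
      (((m.factorial : ℝ)⁻¹) • ∑ J : Fin m → Fin n, fderiv ℝ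
      (FF p ψ (Fin.cons (α := fun _ => Fin n) i J) (Fin.cons (α := fun _ => Fin n) j J)) x) x :=
    (HasFDerivAt.fun_sum fun t _ =>
      ((FF_C1 hp hψ _ _).1.differentiable one_ne_zero x).hasFDerivAt).const_mul _
  unfold TT
  unfold pd7
  by_cases h : i = j
  · subst h
    simp only [if_true] at h2 ⊢
    rw [((h1.const_mul (1/p)).fun_sub h2).fderiv]
    simp
  · simp only [h, if_false]
    rw [((hasFDerivAt_const (0:ℝ) x).fun_sub h2).fderiv]
    simp

lemma TT_div {p : ℝ} (hp : 1 < p) {ψ : EE → (Fin (m+1) → Fin n) → ℝ}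
    (hψ : ∀ t, ContDiff ℝ 1 (fun x => ψ x t)) (halt : ∀ x, IsAltForm7 n (m+1) (ψ x))
    (hclosed : IsClosed7 ψ) (hk : 0 < m + 1) (hcocl : IsPCoclosed7 hk p ψ) (j : Fin n) (x : EE) :
    ∑ i, pd7 (TT p ψ i j) i x = 0 := by
  simp only [TT_fderiv hp hψ]
  by_cases hx : nrm7 ψ x = 0
  · simp [pd7, (nrm7_pow_C1 hp hψ).2 x hx, fun a b => (FF_C1 hp hψ a b).2 x hx]
  · have hd : ∀ t, HasFDerivAt (fun x => ψ x t) (fderiv ℝ (fun x => ψ x t) x) x := fun t =>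
      ((hψ t).differentiable one_ne_zero x).hasFDerivAt
    have hx' : ((m+1).factorial : ℝ)⁻¹ * ∑ t, ψ x t ^ 2 ≠ 0 := by
      rw [← nrm7_sq]; exact pow_ne_zero 2 hx
    have hSd : HasFDerivAt (fun x => ((m+1).factorial : ℝ)⁻¹ * ∑ t, ψ x t ^ 2)
        (((m+1).factorial : ℝ)⁻¹ • ∑ t, (2 * ψ x t) • fderiv ℝ (fun x => ψ x t) x) x := by
      have : HasFDerivAt (fun x => ∑ t, ψ x t ^ 2)
          (∑ t, (2 * ψ x t) • fderiv ℝ (fun x => ψ x t) x) x := by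
        apply HasFDerivAt.fun_sum
        intro t _
        simpa using (hd t).pow 2
      exact this.const_mul _
    have hNd : ∀ r : ℝ, HasFDerivAt (fun x => nrm7 ψ x ^ r) _ x := fun r => by
      simp only [nrm7_rpow ψ _ r]
      exact hSd.rpow_const (p := r / 2) (Or.inl hx')
    have e1 : pd7 (fun x => nrm7 ψ x ^ p) j x = p * nrm7 ψ x ^ (p - 2) *
        (((m+1).factorial : ℝ)⁻¹ * ∑ t, ψ x t * pd7 (fun x => ψ x t) j x) := by
      unfold pd7
      rw [(hNd p).fderiv, nrm7_rpow ψ x (p-2)]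
      have : (p - 2) / 2 = p / 2 - 1 := by ring
      rw [this]
      simp only [smul_apply, sum_apply, smul_eq_mul]
      simp only [mul_assoc, ← Finset.mul_sum]
      ring
    have e2 : ∀ i J, pd7 (FF p ψ (Fin.cons (α := fun _ => Fin n) i J)
        (Fin.cons (α := fun _ => Fin n) j J)) i x =
        pd7 (fun y => nrm7 ψ y ^ (p - 2) * ψ y (Fin.cons (α := fun _ => Fin n) i J)) i x *
          ψ x (Fin.cons (α := fun _ => Fin n) j J) +
        nrm7 ψ x ^ (p - 2) * (ψ x (Fin.cons (α := fun _ => Fin n) i J) *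
          pd7 (fun y => ψ y (Fin.cons (α := fun _ => Fin n) j J)) i x) := by
      intro i J
      have h1 : DifferentiableAt ℝ (fun y => nrm7 ψ y ^ (p - 2) *
        ψ y (Fin.cons (α := fun _ => Fin n) i J)) x :=
        (hNd (p-2)).differentiableAt.mul (hd _).differentiableAt
      have h2 := h1.hasFDerivAt.mul (hd (Fin.cons (α := fun _ => Fin n) j J))
      have h3 : HasFDerivAt (FF p ψ (Fin.cons (α := fun _ => Fin n) i J)
        (Fin.cons (α := fun _ => Fin n) j J)) _ x := h2
      unfold pd7
      rw [h3.fderiv]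
      simp
      ring
    have e3 : ∀ J : Fin m → Fin n, ∑ i,
        pd7 (fun y => nrm7 ψ y ^ (p - 2) * ψ y (Fin.cons (α := fun _ => Fin n) i J)) i x = 0 :=
      fun J => hcocl x J
    have e4 := closed_contract (halt x) (fun i t => pd7 (fun y => ψ y t) i x)
      (fun t => hclosed x t) j
    rw [Finset.sum_sub_distrib, Finset.sum_ite_eq' Finset.univ j, ← Finset.mul_sum, Finset.sum_comm]
    simp only [Finset.mem_univ, if_true, e1, e2, Finset.sum_add_distrib, ← Finset.sum_mul, e3,
      zero_mul, ← Finset.mul_sum, e4, zero_add]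
    rw [Finset.sum_comm, Nat.factorial_succ]
    have : (m.factorial : ℝ) ≠ 0 := by positivity
    have : (m + 1 : ℝ) ≠ 0 := by positivity
    have : p ≠ 0 := by linarith
    push_cast
    field_simp
    ring

lemma TT_trace {p : ℝ} (hp : 1 < p) (ψ : EE → (Fin (m+1) → Fin n) → ℝ) (x : EE) :
    ∑ i, TT p ψ i i x = ((n : ℝ) - (m + 1 : ℕ) * p) / p * nrm7 ψ x ^ p := by
  unfold TT
  simp only [if_true]
  rw [Finset.sum_sub_distrib, ← Finset.mul_sum, ← Finset.mul_sum,
    ← sum_tuple_cons (fun t => FF p ψ t t x)]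
  have h := nrm7_pow_eq hp ψ x
  have h2 : ∑ t, FF p ψ t t x = ((m+1).factorial : ℝ) * nrm7 ψ x ^ p := by
    rw [h]; field_simp
  rw [h2, Nat.factorial_succ]
  have : (m.factorial : ℝ) ≠ 0 := by positivity
  have : p ≠ 0 := by linarith
  simp
  field_simp

lemma TT_quad {p : ℝ} (ψ : EE → (Fin (m+1) → Fin n) → ℝ) (x : EE) :
    ∑ i, ∑ j, x i * x j * TT p ψ i j x ≤ 1 / p * (‖x‖ ^ 2 * nrm7 ψ x ^ p) := by
  have h1 : ∑ i, ∑ j, x i * x j * TT p ψ i j x = 1 / p * (‖x‖ ^ 2 * nrm7 ψ x ^ p) -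
      (m.factorial : ℝ)⁻¹ * ∑ J : Fin m → Fin n, nrm7 ψ x ^ (p - 2) *
        (∑ i, x i * ψ x (Fin.cons (α := fun _ => Fin n) i J)) ^ 2 := by
    unfold TT FF
    simp only [mul_sub, Finset.sum_sub_distrib]
    congr 1
    · simp only [mul_ite, mul_zero, Finset.sum_ite_eq, Finset.mem_univ, if_true]
      rw [EuclideanSpace.real_norm_sq_eq, Finset.sum_mul, Finset.mul_sum]
      exact Finset.sum_congr rfl fun i _ => by ring
    · have hsq : ∀ J : Fin m → Fin n, (∑ i, x i * ψ x (Fin.cons (α := fun _ => Fin n) i J)) ^ 2 =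
          ∑ i, ∑ j, x i * ψ x (Fin.cons (α := fun _ => Fin n) i J) *
            (x j * ψ x (Fin.cons (α := fun _ => Fin n) j J)) := fun J => by
        rw [sq, Finset.sum_mul_sum]
      simp only [hsq, Finset.mul_sum]
      rw [Finset.sum_comm (s := (Finset.univ : Finset (Fin m → Fin n)))]
      refine Finset.sum_congr rfl fun i _ => ?_
      rw [Finset.sum_comm (s := (Finset.univ : Finset (Fin m → Fin n)))]
      refine Finset.sum_congr rfl fun j _ => Finset.sum_congr rfl fun J _ => by ring
  rw [h1]
  have : 0 ≤ (m.factorial : ℝ)⁻¹ * ∑ J : Fin m → Fin n, nrm7 ψ x ^ (p - 2) *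
        (∑ i, x i * ψ x (Fin.cons (α := fun _ => Fin n) i J)) ^ 2 :=
    mul_nonneg (by positivity) (Finset.sum_nonneg fun J _ =>
      mul_nonneg (Real.rpow_nonneg (nrm7_nonneg ψ x) _) (sq_nonneg _))
  linarith

/-- main integral inequality -/
lemma main_ineq {p : ℝ} (hp : 1 < p) {ψ : EE → (Fin (m+1) → Fin n) → ℝ}
    (hψ : ∀ t, ContDiff ℝ 1 (fun x => ψ x t)) (halt : ∀ x, IsAltForm7 n (m+1) (ψ x))
    (hclosed : IsClosed7 ψ) (hk : 0 < m + 1) (hcocl : IsPCoclosed7 hk p ψ)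
    {ζ g : EE → ℝ} (hζ : ContDiff ℝ 1 ζ) (hsupp : HasCompactSupport ζ)
    (hg : ∀ x i, pd7 ζ i x = g x * x i) (hg0 : ∀ x, g x ≤ 0)
    (hgc : Continuous g) (hgs : HasCompactSupport g) :
    ∫ x, (((n : ℝ) - (m + 1 : ℕ) * p) * ζ x + ‖x‖ ^ 2 * g x) * nrm7 ψ x ^ p ≤ 0 := by
  have hT := TT_C1 hp hψ
  have hTc : ∀ i j, Continuous (TT p ψ i j) := fun i j => (hT i j).continuous
  have hco : ∀ j : Fin n, ContDiff ℝ 1 (fun x : EE => x j) := fun j => by fun_prop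
  have hpd : ∀ i j (x : EE), fderiv ℝ (fun x : EE => ζ x * x j) x (EuclideanSpace.single i 1) =
      (if i = j then ζ x else 0) + g x * (x i * x j) := by
    intro i j x
    have h1 := (hζ.differentiable one_ne_zero x).hasFDerivAt
    have h2 : HasFDerivAt (fun x : EE => x j) (EuclideanSpace.proj j : EE →L[ℝ] ℝ) x :=
      (EuclideanSpace.proj j : EE →L[ℝ] ℝ).hasFDerivAt
    have h3 : HasFDerivAt (fun x : EE => ζ x * x j) _ x := h1.mul h2
    have h4 := hg x i
    unfold pd7 at h4
    rw [h3.fderiv]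
    simp only [add_apply, smul_apply, h4]
    by_cases h : i = j
    · subst h; simp; ring
    · have h' : ¬ j = i := fun h' => h h'.symm
      simp [h, h']; ring
  have hint : ∀ u : EE → ℝ, Continuous u → HasCompactSupport u → Integrable u := fun u h1 h2 =>
    h1.integrable_of_hasCompactSupport h2
  have hpc : ∀ i j, Continuous (fun x => pd7 (TT p ψ i j) i x) := fun i j =>
    ((hT i j).continuous_fderiv one_ne_zero).clm_apply continuous_const
  have i1 : ∀ i j, Integrable (fun x => ((if i = j then ζ x else 0) + g x * (x i * x j))
      * TT p ψ i j x) := by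
    intro i j
    by_cases h : i = j
    · simp only [h, if_true]
      refine hint _ (by have := hζ.continuous; have := hTc j j; fun_prop) ?_
      exact (hsupp.add hgs.mul_right).mul_right
    · simp only [h, if_false, zero_add]
      refine hint _ (by have := hTc i j; fun_prop) ?_
      exact (hgs.mul_right).mul_right
  have i2 : ∀ i j, Integrable (fun x : EE => (ζ x * x j) * pd7 (TT p ψ i j) i x) := by
    intro i j
    refine hint _ (by have := hζ.continuous; have := hpc i j; fun_prop) ?_
    exact (hsupp.mul_right).mul_right
  have ibp : ∀ i j, ∫ x : EE, (ζ x * x j) * pd7 (TT p ψ i j) i x =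
      - ∫ x, ((if i = j then ζ x else 0) + g x * (x i * x j)) * TT p ψ i j x := by
    intro i j
    have := integral_mul_fderiv_eq_neg_fderiv_mul_of_integrable (μ := (volume : Measure EE))
      (f := fun x : EE => ζ x * x j) (g := TT p ψ i j) (v := EuclideanSpace.single i 1)
      (by simp only [hpd]; exact i1 i j) (i2 i j)
      (hint _ (by have := hζ.continuous; have := hTc i j; fun_prop)
        ((hsupp.mul_right).mul_right))
      (fun x _ => (hζ.mul (hco j)).differentiable one_ne_zero x)
      (fun x _ => (hT i j).differentiable one_ne_zero x)
    simp only [hpd] at this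
    exact this
  have s1 : ∑ j, ∑ i, ∫ x : EE, (ζ x * x j) * pd7 (TT p ψ i j) i x = 0 := by
    refine Finset.sum_eq_zero fun j _ => ?_
    rw [← integral_finsetSum _ fun i _ => i2 i j]
    simp only [← Finset.mul_sum, TT_div hp hψ halt hclosed hk hcocl j, mul_zero, integral_zero]
  have s2 : ∫ x, ∑ j, ∑ i, ((if i = j then ζ x else 0) + g x * (x i * x j)) * TT p ψ i j x = 0 := by
    rw [integral_finsetSum _ fun j _ => integrable_finsetSum _ fun i _ => i1 i j]
    simp only [integral_finsetSum _ fun i _ => i1 i _]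
    simp only [ibp, Finset.sum_neg_distrib] at s1
    linarith
  have s3 : ∀ x, (((n : ℝ) - (m + 1 : ℕ) * p) * ζ x + ‖x‖ ^ 2 * g x) * nrm7 ψ x ^ p ≤
      p * ∑ j, ∑ i, ((if i = j then ζ x else 0) + g x * (x i * x j)) * TT p ψ i j x := by
    intro x
    have h1 : ∑ j, ∑ i, ((if i = j then ζ x else 0) + g x * (x i * x j)) * TT p ψ i j x =
        ζ x * ∑ i, TT p ψ i i x + g x * ∑ i, ∑ j, x i * x j * TT p ψ i j x := by
      simp only [add_mul, Finset.sum_add_distrib, ite_mul, zero_mul, Finset.sum_ite_eq',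
        Finset.mem_univ, if_true, ← Finset.mul_sum, mul_assoc]
      rw [Finset.sum_comm]
      simp only [Finset.mul_sum]
    rw [h1, TT_trace hp]
    have h2 := mul_le_mul_of_nonpos_left (TT_quad (p := p) ψ x) (hg0 x)
    have hp0 : 0 < p := by linarith
    have h3 := mul_le_mul_of_nonneg_left h2 hp0.le
    have h4 : p * (g x * (1 / p * (‖x‖ ^ 2 * nrm7 ψ x ^ p))) = ‖x‖^2 * g x * nrm7 ψ x ^ p := by
      field_simp
    have h5 : p * (ζ x * (((n : ℝ) - (m + 1 : ℕ) * p) / p * nrm7 ψ x ^ p)) =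
      ((n : ℝ) - (m + 1 : ℕ) * p) * ζ x * nrm7 ψ x ^ p := by
      field_simp
    rw [mul_add, add_mul, h5]
    linarith
  have hNc : Continuous (fun x => nrm7 ψ x ^ p) := (nrm7_pow_C1 hp hψ).1.continuous
  calc _ ≤ ∫ x, p * ∑ j, ∑ i, ((if i = j then ζ x else 0) + g x * (x i * x j)) * TT p ψ i j x := by
        refine integral_mono ?_ ?_ s3
        · refine hint _ (by have := hζ.continuous; fun_prop) ?_
          exact (HasCompactSupport.add hsupp.mul_left hgs.mul_left).mul_right
        · exact (integrable_finsetSum _ fun j _ => integrable_finsetSum _ fun i _ => i1 i j).const_mul p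
    _ = 0 := by rw [integral_const_mul, s2, mul_zero]

end Stress

section Cutoff

def H7 (a c s : ℝ) : ℝ := (max (s ^ a - c) 0) ^ 2 / s ^ a

def H7' (a c s : ℝ) : ℝ :=
  a * s ^ (a - 1) * (max (s ^ a - c) 0 * (2 * s ^ a - max (s ^ a - c) 0)) / (s ^ a) ^ 2

lemma hasDerivAt_maxsq (y : ℝ) : HasDerivAt (fun y : ℝ => (max y 0) ^ 2) (2 * max y 0) y := by
  rcases lt_trichotomy y 0 with h | h | h
  · rw [max_eq_right h.le, mul_zero]
    refine (hasDerivAt_const y (0:ℝ)).congr_of_eventuallyEq ?_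
    filter_upwards [eventually_lt_nhds h] with z hz
    rw [max_eq_right hz.le]; norm_num
  · subst h
    rw [max_self, mul_zero, hasDerivAt_iff_isLittleO]
    have h1 : (fun z : ℝ => (max z 0) ^ 2) =O[nhds 0] (fun z : ℝ => z ^ 2) := by
      refine IsBigO.of_bound 1 (Eventually.of_forall fun z => ?_)
      rw [one_mul, norm_pow, norm_pow, Real.norm_eq_abs, Real.norm_eq_abs]
      refine pow_le_pow_left₀ (abs_nonneg _) ?_ 2
      rcases le_total z 0 with h | h
      · rw [max_eq_right h, abs_zero]; exact abs_nonneg z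
      · rw [max_eq_left h]
    have h2 : (fun z : ℝ => z ^ 2) =o[nhds 0] (fun z : ℝ => z) := by
      simpa using isLittleO_pow_pow (𝕜 := ℝ) (m := 1) (n := 2) (by norm_num)
    simpa using h1.trans_isLittleO h2
  · rw [max_eq_left h.le]
    have : HasDerivAt (fun y : ℝ => y ^ 2) (2 * y) y := by simpa using hasDerivAt_pow 2 y
    refine this.congr_of_eventuallyEq ?_
    filter_upwards [eventually_gt_nhds h] with z hz
    rw [max_eq_left hz.le]

lemma H7_hasDerivAt (a c : ℝ) {s : ℝ} (hs : 0 < s) : HasDerivAt (H7 a c) (H7' a c s) s := by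
  have h1 : HasDerivAt (fun s : ℝ => s ^ a) (a * s ^ (a - 1)) s :=
    Real.hasDerivAt_rpow_const (Or.inl hs.ne')
  have h2 : HasDerivAt (fun s : ℝ => (max (s ^ a - c) 0) ^ 2)
      (2 * max (s ^ a - c) 0 * (a * s ^ (a - 1))) s :=
    HasDerivAt.comp (h₂ := fun y : ℝ => (max y 0) ^ 2) (h := fun s : ℝ => s ^ a - c) s
      (hasDerivAt_maxsq (s ^ a - c)) (h1.sub_const c)
  have h3 : HasDerivAt (H7 a c) _ s := h2.div h1 (Real.rpow_pos_of_pos hs a).ne'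
  refine h3.congr_deriv ?_
  unfold H7'
  ring

lemma H7_zero {a c s : ℝ} (h : s ^ a ≤ c) : H7 a c s = 0 := by
  rw [H7, max_eq_right (by linarith)]; simp

lemma H7'_zero {a c s : ℝ} (h : s ^ a ≤ c) : H7' a c s = 0 := by
  rw [H7', max_eq_right (by linarith)]; simp

lemma H7'_nonpos {a c s : ℝ} (ha : a ≤ 0) (hc : 0 ≤ c) (hs : 0 < s) : H7' a c s ≤ 0 := by
  have hw := Real.rpow_pos_of_pos hs a
  have hu := Real.rpow_pos_of_pos hs (a - 1)
  have hM : 0 ≤ max (s ^ a - c) 0 := le_max_right _ _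
  have hM2 : max (s ^ a - c) 0 ≤ s ^ a := max_le (by linarith) hw.le
  unfold H7'
  apply div_nonpos_of_nonpos_of_nonneg _ (sq_nonneg _)
  apply mul_nonpos_of_nonpos_of_nonneg
  · exact mul_nonpos_of_nonpos_of_nonneg ha hu.le
  · exact mul_nonneg hM (by linarith)

/-- pointwise bound inside the support -/
lemma H7_lower {q c s : ℝ} (hs : 0 < s) (hsc : c < s ^ (-q/2)) :
    q * H7 (-q/2) c s + (s - 1) * (2 * H7' (-q/2) c s) =
      q * (-2 * c + 2 * c ^ 2 / s ^ (-q/2) + s ^ (-q/2 - 1) * (1 - c ^ 2 / (s ^ (-q/2)) ^ 2)) := by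
  have hw := Real.rpow_pos_of_pos hs (-q/2)
  have e : s ^ (-q/2) = s * s ^ (-q/2 - 1) := by
    rw [Real.rpow_sub_one hs.ne']; field_simp
  unfold H7 H7'
  rw [max_eq_left (by linarith)]
  have hw' := hw.ne'
  generalize hu : s ^ (-q/2 - 1) = u at *
  generalize hW : s ^ (-q/2) = W at *
  have e2 : (s - 1) * (2 * (-q / 2 * u * ((W - c) * (2 * W - (W - c))) / W ^ 2)) =
    -q * (W - u) * ((W - c) * (W + c)) / W ^ 2 := by
    rw [e]; ring
  rw [e2]
  field_simp
  ring

variable {n : ℕ}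

local notation "EE" => EuclideanSpace ℝ (Fin n)

lemma zeta_hasFDerivAt (a c : ℝ) (x : EE) : HasFDerivAt (fun x : EE => H7 a c (1 + ‖x‖ ^ 2))
    (H7' a c (1 + ‖x‖ ^ 2) • ((2 : ℝ) • innerSL ℝ x)) x := by
  have h1 : HasFDerivAt (fun x : EE => 1 + ‖x‖ ^ 2) ((2 : ℝ) • innerSL ℝ x) x := by
    have := (hasStrictFDerivAt_norm_sq x).hasFDerivAt.const_add 1
    refine this.congr_fderiv ?_
    ext v
    simp
  exact (H7_hasDerivAt a c (by positivity)).comp_hasFDerivAt x h1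

lemma H7'_cont (a c : ℝ) : Continuous (fun x : EE => H7' a c (1 + ‖x‖ ^ 2)) := by
  have h : ∀ b : ℝ, Continuous (fun x : EE => (1 + ‖x‖ ^ 2) ^ b) := fun b =>
    Continuous.rpow_const (by fun_prop) fun x => Or.inl (by positivity)
  unfold H7'
  have h1 := h a
  have h2 := h (a - 1)
  refine Continuous.div ?_ (by fun_prop) (fun x => by positivity)
  fun_prop

end Cutoff

section Final

variable {n m : ℕ}

local notation "EE" => EuclideanSpace ℝ (Fin n)

lemma ball_ineq {p : ℝ} (hp : 1 < p) {ψ : EE → (Fin (m+1) → Fin n) → ℝ}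
    (hψ : ∀ t, ContDiff ℝ 1 (fun x => ψ x t)) (halt : ∀ x, IsAltForm7 n (m+1) (ψ x))
    (hclosed : IsClosed7 ψ) (hk : 0 < m + 1) (hcocl : IsPCoclosed7 hk p ψ)
    {q : ℝ} (hq : q = (n : ℝ) - (m + 1 : ℕ) * p) (hq0 : 0 < q) {ρ R : ℝ} (hρ : 0 < ρ) (hR : ρ ≤ R)
    (hc : 2 * (1 + R ^ 2) ^ (-q/2) ≤ (1 + ρ ^ 2) ^ (-q/2)) :
    (1 + ρ ^ 2) ^ (-q/2 - 1) / 2 * ∫ x in Metric.ball (0 : EE) ρ, nrm7 ψ x ^ p ≤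
      2 * (1 + R ^ 2) ^ (-q/2) * ∫ x in Metric.ball (0 : EE) R, nrm7 ψ x ^ p := by
  set c : ℝ := (1 + R ^ 2) ^ (-q/2) with hcdef
  have hc0 : 0 < c := by positivity
  have hNc : Continuous (fun x => nrm7 ψ x ^ p) := (nrm7_pow_C1 hp hψ).1.continuous
  have hN0 : ∀ x, 0 ≤ nrm7 ψ x ^ p := fun x => Real.rpow_nonneg (nrm7_nonneg ψ x) _
  have hR0 : 0 < R := hρ.trans_le hR
  have hout : ∀ x : EE, R ≤ ‖x‖ → (1 + ‖x‖ ^ 2) ^ (-q/2) ≤ c := fun x hx =>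
    Real.rpow_le_rpow_of_nonpos (by positivity) (by gcongr) (by linarith)
  have hin : ∀ x : EE, ‖x‖ < R → c < (1 + ‖x‖ ^ 2) ^ (-q/2) := fun x hx =>
    Real.rpow_lt_rpow_of_neg (by positivity) (by gcongr) (by linarith)
  have hcs : ∀ G : EE → ℝ, (∀ x, R ≤ ‖x‖ → G x = 0) → HasCompactSupport G := by
    intro G hG
    refine HasCompactSupport.intro (isCompact_closedBall (0 : EE) R) fun x hx => hG x ?_
    simp at hx
    exact hx.le
  have hgc : Continuous (fun x : EE => 2 * H7' (-q/2) c (1 + ‖x‖ ^ 2)) :=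
    continuous_const.mul (H7'_cont _ _)
  have hζ : ContDiff ℝ 1 (fun x : EE => H7 (-q/2) c (1 + ‖x‖ ^ 2)) :=
    contDiff_one_iff_hasFDerivAt.mpr ⟨fun x => H7' (-q/2) c (1 + ‖x‖ ^ 2) • ((2 : ℝ) • innerSL ℝ x),
      (H7'_cont _ _).smul ((innerSL ℝ).continuous.const_smul (2 : ℝ)), fun x => zeta_hasFDerivAt _ _ x⟩
  have hs1 : HasCompactSupport (fun x : EE => H7 (-q/2) c (1 + ‖x‖ ^ 2)) :=
    hcs _ fun x hx => H7_zero (hout x hx)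
  have hs2 : HasCompactSupport (fun x : EE => 2 * H7' (-q/2) c (1 + ‖x‖ ^ 2)) :=
    hcs _ fun x hx => by rw [H7'_zero (hout x hx), mul_zero]
  have key := main_ineq hp hψ halt hclosed hk hcocl hζ hs1 (g := fun x : EE => 2 * H7' (-q/2) c (1 + ‖x‖ ^ 2))
    (fun x i => by
      unfold pd7
      rw [(zeta_hasFDerivAt _ _ x).fderiv]
      simp [EuclideanSpace.inner_single_right]
      ring)
    (fun x => by have := H7'_nonpos (a := -q/2) (c := c) (s := 1 + ‖x‖ ^ 2) (by linarith) hc0.le (by positivity); linarith)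
    hgc hs2
  rw [← hq] at key
  have pw : ∀ x : EE, q * ((1 + ρ ^ 2) ^ (-q/2 - 1) / 2 *
      (Metric.ball (0 : EE) ρ).indicator (fun x => nrm7 ψ x ^ p) x -
      2 * c * (Metric.ball (0 : EE) R).indicator (fun x => nrm7 ψ x ^ p) x) ≤
      (q * H7 (-q/2) c (1 + ‖x‖ ^ 2) + ‖x‖ ^ 2 * (2 * H7' (-q/2) c (1 + ‖x‖ ^ 2))) * nrm7 ψ x ^ p := by
    intro x
    by_cases hxR : ‖x‖ < R
    · have hl := H7_lower (q := q) (c := c) (s := 1 + ‖x‖ ^ 2) (by positivity) (hin x hxR)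
      have e : (1 + ‖x‖ ^ 2 - 1) = ‖x‖ ^ 2 := by ring
      rw [e] at hl
      rw [hl, Set.indicator_of_mem (s := Metric.ball (0 : EE) R) (by simpa using hxR), mul_assoc q]
      refine mul_le_mul_of_nonneg_left ?_ hq0.le
      have hw : 0 < (1 + ‖x‖ ^ 2) ^ (-q/2) := by positivity
      have hu : 0 < (1 + ‖x‖ ^ 2) ^ (-q/2 - 1) := by positivity
      have hd : 0 ≤ 2 * c ^ 2 / (1 + ‖x‖ ^ 2) ^ (-q/2) := by positivity
      by_cases hxρ : ‖x‖ < ρ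
      · rw [Set.indicator_of_mem (by simpa using hxρ), ← sub_mul]
        refine mul_le_mul_of_nonneg_right ?_ (hN0 x)
        have h1 : (1 + ρ ^ 2) ^ (-q/2) ≤ (1 + ‖x‖ ^ 2) ^ (-q/2) :=
          Real.rpow_le_rpow_of_nonpos (by positivity) (by gcongr) (by linarith)
        have h2 : (1 + ρ ^ 2) ^ (-q/2 - 1) ≤ (1 + ‖x‖ ^ 2) ^ (-q/2 - 1) :=
          Real.rpow_le_rpow_of_nonpos (by positivity) (by gcongr) (by linarith)
        have h3 : c ^ 2 / ((1 + ‖x‖ ^ 2) ^ (-q/2)) ^ 2 ≤ 1 / 2 := by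
          rw [div_le_iff₀ (by positivity)]
          nlinarith
        have h4 : (1 + ‖x‖ ^ 2) ^ (-q/2 - 1) * (1/2) ≤ (1 + ‖x‖ ^ 2) ^ (-q/2 - 1) *
          (1 - c ^ 2 / ((1 + ‖x‖ ^ 2) ^ (-q/2)) ^ 2) :=
          mul_le_mul_of_nonneg_left (by linarith) hu.le
        linarith
      · rw [Set.indicator_of_notMem (by simpa using hxρ), mul_zero, zero_sub, ← neg_mul]
        refine mul_le_mul_of_nonneg_right ?_ (hN0 x)
        have h3 : c ^ 2 / ((1 + ‖x‖ ^ 2) ^ (-q/2)) ^ 2 ≤ 1 := by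
          rw [div_le_iff₀ (by positivity)]
          have := hin x hxR
          nlinarith
        have h4 := mul_nonneg hu.le (sub_nonneg.mpr h3)
        linarith
    · have h1 : ¬ ‖x‖ < ρ := fun h => hxR (h.trans_le hR)
      rw [Set.indicator_of_notMem (by simpa using h1), Set.indicator_of_notMem (by simpa using hxR),
        H7_zero (hout x (not_lt.mp hxR)), H7'_zero (hout x (not_lt.mp hxR))]
      simp
  have hib : ∀ r, Integrable ((Metric.ball (0 : EE) r).indicator (fun x => nrm7 ψ x ^ p)) := by
    intro r
    rw [integrable_indicator_iff Metric.isOpen_ball.measurableSet]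
    exact (hNc.continuousOn.integrableOn_compact (isCompact_closedBall (0 : EE) r)).mono_set
      Metric.ball_subset_closedBall
  have hi := integral_mono ((((hib ρ).const_mul ((1 + ρ ^ 2) ^ (-q/2 - 1) / 2)).sub
    ((hib R).const_mul (2 * c))).const_mul q) (g := fun x : EE =>
      (q * H7 (-q/2) c (1 + ‖x‖ ^ 2) + ‖x‖ ^ 2 * (2 * H7' (-q/2) c (1 + ‖x‖ ^ 2))) * nrm7 ψ x ^ p)
    (by
      refine Continuous.integrable_of_hasCompactSupport ?_ ?_
      · have := hζ.continuous
        fun_prop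
      · exact (HasCompactSupport.add hs1.mul_left hs2.mul_left).mul_right) pw
  have hi2 := hi.trans key
  simp only [Pi.sub_apply] at hi2
  rw [integral_const_mul, integral_sub ((hib ρ).const_mul _) ((hib R).const_mul _),
    integral_const_mul, integral_const_mul, integral_indicator Metric.isOpen_ball.measurableSet,
    integral_indicator Metric.isOpen_ball.measurableSet] at hi2
  have := nonpos_of_mul_nonpos_right hi2 hq0
  linarith

lemma final {p : ℝ} (hp : 1 < p) {ψ : EE → (Fin (m+1) → Fin n) → ℝ}
    (hψ : ∀ t, ContDiff ℝ 1 (fun x => ψ x t)) (halt : ∀ x, IsAltForm7 n (m+1) (ψ x))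
    (hclosed : IsClosed7 ψ) (hk : 0 < m + 1) (hcocl : IsPCoclosed7 hk p ψ)
    {q : ℝ} (hq : q = (n : ℝ) - (m + 1 : ℕ) * p) (hq0 : 0 < q)
    (hgrowth : (fun R : ℝ => ∫ x in Metric.ball (0 : EuclideanSpace ℝ (Fin n)) R,
        nrm7 ψ x ^ p) =o[atTop] fun R : ℝ => R ^ q) (x : EE) : nrm7 ψ x = 0 := by
  have hNc : Continuous (fun x => nrm7 ψ x ^ p) := (nrm7_pow_C1 hp hψ).1.continuous
  have hN0 : ∀ x, 0 ≤ nrm7 ψ x ^ p := fun x => Real.rpow_nonneg (nrm7_nonneg ψ x) _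
  set ρ : ℝ := ‖x‖ + 1 with hρd
  have hρ : 0 < ρ := by positivity
  have hcR : ∀ R : ℝ, 0 < R → (1 + R ^ 2) ^ (-q/2) ≤ R ^ (-q) := by
    intro R hR
    have e : R ^ (-q) = (R ^ 2) ^ (-q/2) := by
      rw [← Real.rpow_natCast, ← Real.rpow_mul hR.le]; congr 1; push_cast; ring
    rw [e]
    exact Real.rpow_le_rpow_of_nonpos (by positivity) (by linarith) (by linarith)
  have hle : (1 + ρ ^ 2) ^ (-q/2 - 1) / 2 * ∫ x in Metric.ball (0 : EE) ρ, nrm7 ψ x ^ p ≤ 0 := by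
    refine le_of_forall_pos_le_add fun ε hε => ?_
    have h1 := hgrowth.def (c := ε / 2) (by positivity)
    have h2 : ∀ᶠ R : ℝ in atTop, R ^ (-q) < (1 + ρ ^ 2) ^ (-q/2) / 2 :=
      (tendsto_rpow_neg_atTop hq0).eventually_lt_const (by positivity)
    obtain ⟨R, hR1, hR2, hR3⟩ := (h1.and (h2.and (eventually_ge_atTop ρ))).exists
    have hR0 : 0 < R := hρ.trans_le hR3
    have h3 := ball_ineq hp hψ halt hclosed hk hcocl hq hq0 hρ hR3 (by
      have := hcR R hR0; linarith)
    have hI0 : 0 ≤ ∫ x in Metric.ball (0 : EE) R, nrm7 ψ x ^ p := integral_nonneg hN0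
    rw [Real.norm_of_nonneg hI0, Real.norm_of_nonneg (Real.rpow_nonneg hR0.le _)] at hR1
    have h4 : (1 + R ^ 2) ^ (-q/2) * ∫ x in Metric.ball (0 : EE) R, nrm7 ψ x ^ p ≤
        R ^ (-q) * (ε / 2 * R ^ q) :=
      mul_le_mul (hcR R hR0) hR1 hI0 (Real.rpow_nonneg hR0.le _)
    have h5 : R ^ (-q) * (ε / 2 * R ^ q) = ε / 2 := by
      rw [mul_left_comm, ← Real.rpow_add hR0]; simp
    linarith
  have hI : ∫ x in Metric.ball (0 : EE) ρ, nrm7 ψ x ^ p = 0 := by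
    refine le_antisymm ?_ (integral_nonneg hN0)
    exact nonpos_of_mul_nonpos_right hle (by positivity)
  have hint : IntegrableOn (fun x => nrm7 ψ x ^ p) (Metric.ball (0 : EE) ρ) :=
    (hNc.continuousOn.integrableOn_compact (isCompact_closedBall (0 : EE) ρ)).mono_set
      Metric.ball_subset_closedBall
  rw [integral_eq_zero_iff_of_nonneg hN0 hint] at hI
  have hon := Measure.eqOn_open_of_ae_eq hI Metric.isOpen_ball hNc.continuousOn continuousOn_const
  have hx := hon (show x ∈ Metric.ball (0 : EE) ρ by simp [hρd])
  simp only [Pi.zero_apply] at hx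
  exact (Real.rpow_eq_zero (nrm7_nonneg ψ x) (by linarith)).mp hx

end Final

/-- Liouville theorem for `p`-harmonic `k`-forms on `ℝⁿ` (`n > kp`,
`p > 1`): if `∫_{B_R(0)} |ψ|^p = o(R^{n−kp})` as `R → ∞`, then `ψ ≡ 0`. -/
theorem stmt_7 (n k : ℕ) (p : ℝ) (hk : 0 < k) (hp : 1 < p) (hn : (k : ℝ) * p < n)
    (ψ : EuclideanSpace ℝ (Fin n) → (Fin k → Fin n) → ℝ)
    (hsmooth : ∀ t, ContDiff ℝ (⊤ : ℕ∞) (fun x => ψ x t))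
    (halt : ∀ x, IsAltForm7 n k (ψ x))
    (hclosed : IsClosed7 ψ) (hcocl : IsPCoclosed7 hk p ψ)
    (hgrowth : (fun R : ℝ => ∫ x in Metric.ball (0 : EuclideanSpace ℝ (Fin n)) R,
        nrm7 ψ x ^ p) =o[atTop] fun R : ℝ => R ^ ((n : ℝ) - k * p)) :
    ∀ x t, ψ x t = 0 := by
  obtain ⟨m, rfl⟩ : ∃ m, k = m + 1 := ⟨k - 1, by omega⟩
  intro x t
  have hψ : ∀ t, ContDiff ℝ 1 (fun x => ψ x t) := fun t =>
    (hsmooth t).of_le (by exact_mod_cast le_top)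
  exact nrm7_zero_iff ψ x
    (final hp hψ halt hclosed hk hcocl rfl (by linarith) hgrowth x) t

end
end

section
/- Let u : ℝⁿ → ℝᵐ be a C² solution of Δu = ∇W(u) with W ≥ 0, and suppose n ≥ 3. Then for every x₀ ∈ ℝⁿ, the function R ↦ R^{2−n} ∫_{B_R(x₀)} ((1/2)|∇u|² + W(u)) dx is monotone non-decreasing in R > 0. -/
open MeasureTheory

noncomputable section

def pd15 {n : ℕ} {F : Type*} [NormedAddCommGroup F] [NormedSpace ℝ F]
    (f : EuclideanSpace ℝ (Fin n) → F) (i : Fin n) (x : EuclideanSpace ℝ (Fin n)) : F :=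
  fderiv ℝ f x (EuclideanSpace.single i 1)

/-- energy density `e(u) = ½|∇u|² + W(u)`. -/
def eDens15 {n m : ℕ} (u : EuclideanSpace ℝ (Fin n) → EuclideanSpace ℝ (Fin m))
    (W : EuclideanSpace ℝ (Fin m) → ℝ) (x : EuclideanSpace ℝ (Fin n)) : ℝ :=
  (1 / 2) * ∑ i : Fin n, ‖pd15 u i x‖ ^ 2 + W (u x)

/-- The field `V_i = ⟪Du(x)(x-x₀), ∂_i u⟫`. -/
def vf15 {n m : ℕ} (u : EuclideanSpace ℝ (Fin n) → EuclideanSpace ℝ (Fin m))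
    (x₀ : EuclideanSpace ℝ (Fin n)) (i : Fin n) (x : EuclideanSpace ℝ (Fin n)) : ℝ :=
  inner ℝ (fderiv ℝ u x (x - x₀)) (pd15 u i x)

lemma contDiff_pd15 {n m : ℕ} {u : EuclideanSpace ℝ (Fin n) → EuclideanSpace ℝ (Fin m)}
    (hu : ContDiff ℝ 2 u) (i : Fin n) : ContDiff ℝ 1 (pd15 u i) := by
  have h1 : ContDiff ℝ 1 (fderiv ℝ u) := hu.fderiv_right (by norm_num)
  exact h1.clm_apply contDiff_const

lemma contDiff_vf15 {n m : ℕ} {u : EuclideanSpace ℝ (Fin n) → EuclideanSpace ℝ (Fin m)}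
    (hu : ContDiff ℝ 2 u) (x₀ : EuclideanSpace ℝ (Fin n)) (i : Fin n) :
    ContDiff ℝ 1 (vf15 u x₀ i) := by
  have h1 : ContDiff ℝ 1 (fderiv ℝ u) := hu.fderiv_right (by norm_num)
  exact (h1.clm_apply (contDiff_id.sub contDiff_const)).inner ℝ (contDiff_pd15 hu i)

lemma contDiff_eDens15 {n m : ℕ} {u : EuclideanSpace ℝ (Fin n) → EuclideanSpace ℝ (Fin m)}
    {W : EuclideanSpace ℝ (Fin m) → ℝ}
    (hu : ContDiff ℝ 2 u) (hW : ContDiff ℝ 2 W) : ContDiff ℝ 1 (eDens15 u W) := by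
  unfold eDens15
  refine ContDiff.add (contDiff_const.mul (ContDiff.sum fun i _ => ?_)) ?_
  · exact (contDiff_pd15 hu i).norm_sq ℝ
  · exact (hW.comp hu).of_le (by norm_num)

lemma ident15 {n m : ℕ} {u : EuclideanSpace ℝ (Fin n) → EuclideanSpace ℝ (Fin m)}
    {W : EuclideanSpace ℝ (Fin m) → ℝ} (hu : ContDiff ℝ 2 u) (hW : ContDiff ℝ 2 W)
    (hPDE : ∀ x, ∑ i : Fin n, pd15 (fun y => pd15 u i y) i x = gradient W (u x))
    (x₀ x : EuclideanSpace ℝ (Fin n)) :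
    2 * eDens15 u W x + fderiv ℝ (eDens15 u W) x (x - x₀) =
      ∑ i, fderiv ℝ (vf15 u x₀ i) x (EuclideanSpace.single i 1) + 2 * W (u x) := by
  have h1 : ContDiff ℝ 1 (fderiv ℝ u) := hu.fderiv_right (by norm_num)
  have hA : HasFDerivAt (fderiv ℝ u) (fderiv ℝ (fderiv ℝ u) x) x :=
    (h1.differentiable (by norm_num) x).hasFDerivAt
  set A := fderiv ℝ (fderiv ℝ u) x with hAdef
  have hsymm : ∀ v w, A v w = A w v := by
    have := hu.contDiffAt (x := x) |>.isSymmSndFDerivAt (by simp)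
    intro v w
    exact this v w
  have hp : ∀ i, HasFDerivAt (pd15 u i) (A.flip (EuclideanSpace.single i 1)) x := by
    intro i
    have := hA.clm_apply (hasFDerivAt_const (EuclideanSpace.single i (1:ℝ)) x)
    rw [ContinuousLinearMap.comp_zero, zero_add] at this
    exact this
  have hu' : HasFDerivAt u (fderiv ℝ u x) x := (hu.differentiable (by norm_num) x).hasFDerivAt
  have hW' := (hW.differentiable (by norm_num) (u x)).hasFDerivAt
  have he : fderiv ℝ (eDens15 u W) x (x - x₀) =
      ∑ i, inner ℝ (pd15 u i x) (A (x - x₀) (EuclideanSpace.single i 1)) +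
        inner ℝ (gradient W (u x)) (fderiv ℝ u x (x - x₀)) := by
    have h := ((HasFDerivAt.fun_sum (u := Finset.univ) fun i _ => (hp i).norm_sq).const_mul
      (1/2 : ℝ)).add (hW'.comp x hu')
    have h2 : HasFDerivAt (eDens15 u W) _ x := h
    rw [h2.fderiv]
    simp [Finset.mul_sum]
  have hv : ∀ i, fderiv ℝ (vf15 u x₀ i) x (EuclideanSpace.single i 1) =
      inner ℝ (pd15 u i x) (A (x - x₀) (EuclideanSpace.single i 1)) + ‖pd15 u i x‖ ^ 2 +
      inner ℝ (pd15 (fun y => pd15 u i y) i x) (fderiv ℝ u x (x - x₀)) := by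
    intro i
    have h := (hA.clm_apply ((hasFDerivAt_id x).sub_const x₀)).inner ℝ (hp i)
    have h2 : HasFDerivAt (vf15 u x₀ i) _ x := h
    have h3 : pd15 (fun y => pd15 u i y) i x = A (EuclideanSpace.single i 1)
        (EuclideanSpace.single i 1) := by
      have : fderiv ℝ (fun y => pd15 u i y) x = _ := (hp i).fderiv
      unfold pd15 at this ⊢
      rw [this]; rfl
    rw [h2.fderiv, h3, hsymm (x - x₀)]
    simp only [pd15, ContinuousLinearMap.comp_apply, ContinuousLinearMap.prod_apply,
      fderivInnerCLM_apply, add_apply, ContinuousLinearMap.flip_apply,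
      ContinuousLinearMap.id_apply, id, inner_add_left, real_inner_self_eq_norm_sq]
    rw [real_inner_comm (A _ _) (fderiv ℝ u x (x - x₀)), real_inner_comm (A _ (x - x₀))]
    ring
  rw [he, Finset.sum_congr rfl fun i _ => hv i, Finset.sum_add_distrib, Finset.sum_add_distrib,
    ← sum_inner, hPDE]
  unfold eDens15
  ring

lemma ibp15 {n : ℕ} {φ g : EuclideanSpace ℝ (Fin n) → ℝ} (hφ : ContDiff ℝ 1 φ)
    (hg : ContDiff ℝ 1 g) (hc : HasCompactSupport φ) (v : EuclideanSpace ℝ (Fin n)) :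
    Integrable (fun x => φ x * fderiv ℝ g x v) ∧ Integrable (fun x => fderiv ℝ φ x v * g x) ∧
    ∫ x, φ x * fderiv ℝ g x v = - ∫ x, fderiv ℝ φ x v * g x := by
  have cφ := hφ.continuous
  have cg := hg.continuous
  have cφ' : Continuous fun x => fderiv ℝ φ x v :=
    (hφ.continuous_fderiv (by norm_num)).clm_apply continuous_const
  have cg' : Continuous fun x => fderiv ℝ g x v :=
    (hg.continuous_fderiv (by norm_num)).clm_apply continuous_const
  have i1 : Integrable (fun x => φ x * fderiv ℝ g x v) :=
    (cφ.mul cg').integrable_of_hasCompactSupport hc.mul_right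
  have i2 : Integrable (fun x => fderiv ℝ φ x v * g x) :=
    (cφ'.mul cg).integrable_of_hasCompactSupport (hc.fderiv_apply ℝ v).mul_right
  have i3 : Integrable (fun x => φ x * g x) :=
    (cφ.mul cg).integrable_of_hasCompactSupport hc.mul_right
  exact ⟨i1, i2, integral_mul_fderiv_eq_neg_fderiv_mul_of_integrable i2 i1 i3
    (fun x _ => hφ.differentiable (by norm_num) x) (fun x _ => hg.differentiable (by norm_num) x)⟩

/-- the cutoff -/
def cut15 {n : ℕ} (k : ℕ) (y : EuclideanSpace ℝ (Fin n)) : ℝ :=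
  Real.smoothTransition (k * (1 - ‖y‖ ^ 2))

lemma contDiff_cut15 {n : ℕ} (k : ℕ) : ContDiff ℝ 1 (cut15 (n := n) k) := by
  have h : ContDiff ℝ 1 Real.smoothTransition := Real.smoothTransition.contDiff (n := 1)
  exact h.comp (contDiff_const.mul (contDiff_const.sub (contDiff_id.norm_sq ℝ)))

lemma cut15_zero {n : ℕ} (k : ℕ) {y : EuclideanSpace ℝ (Fin n)} (hy : 1 ≤ ‖y‖) :
    cut15 k y = 0 := by
  apply Real.smoothTransition.zero_of_nonpos
  have : (0:ℝ) ≤ k := k.cast_nonneg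
  have : 1 ≤ ‖y‖ ^ 2 := one_le_pow₀ hy
  nlinarith

lemma compact_cut15 {n : ℕ} (k : ℕ) : HasCompactSupport (cut15 (n := n) k) := by
  refine HasCompactSupport.intro (isCompact_closedBall 0 1) fun y hy => cut15_zero k ?_
  simp at hy
  exact hy.le

lemma fderiv_cut15 {n : ℕ} (k : ℕ) (y : EuclideanSpace ℝ (Fin n)) :
    ∃ c : ℝ, c ≤ 0 ∧ ∀ v, fderiv ℝ (cut15 k) y v = c * inner ℝ y v := by
  have h : ContDiff ℝ 1 Real.smoothTransition := Real.smoothTransition.contDiff (n := 1)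
  have h1 := (h.differentiable (by norm_num) (k * (1 - ‖y‖ ^ 2))).hasDerivAt
  have h2 : HasFDerivAt (fun y : EuclideanSpace ℝ (Fin n) => (k:ℝ) * (1 - ‖y‖ ^ 2)) _ y :=
    ((hasFDerivAt_id y).norm_sq.const_sub 1).const_mul (k:ℝ)
  have h3 : HasFDerivAt (cut15 k) _ y := h1.comp_hasFDerivAt y h2
  have h4 := Real.smoothTransition.monotone.deriv_nonneg (x := k * (1 - ‖y‖ ^ 2))
  refine ⟨-(deriv Real.smoothTransition (k * (1 - ‖y‖ ^ 2)) * (k * 2)), ?_, fun v => ?_⟩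
  · have : (0:ℝ) ≤ k := k.cast_nonneg
    have := mul_nonneg h4 (mul_nonneg this zero_le_two)
    linarith
  · rw [h3.fderiv]
    simp
    ring

lemma sum_single15 {n m : ℕ} (L : EuclideanSpace ℝ (Fin n) →L[ℝ] EuclideanSpace ℝ (Fin m))
    (y : EuclideanSpace ℝ (Fin n)) :
    ∑ i, y i • L (EuclideanSpace.single i 1) = L y := by
  have := (EuclideanSpace.basisFun (Fin n) ℝ).sum_repr y
  simp at this
  conv_rhs => rw [← this]
  simp

lemma key15 {n m : ℕ} {u : EuclideanSpace ℝ (Fin n) → EuclideanSpace ℝ (Fin m)}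
    {W : EuclideanSpace ℝ (Fin m) → ℝ} (hu : ContDiff ℝ 2 u) (hW : ContDiff ℝ 2 W)
    (hWpos : ∀ y, 0 ≤ W y)
    (hPDE : ∀ x, ∑ i : Fin n, pd15 (fun y => pd15 u i y) i x = gradient W (u x))
    (x₀ : EuclideanSpace ℝ (Fin n)) (k : ℕ) {R : ℝ} (hR : 0 < R) :
    0 ≤ ∫ y, cut15 k y * (2 * R * eDens15 u W (x₀ + R • y) +
      R ^ 2 * fderiv ℝ (eDens15 u W) (x₀ + R • y) y) := by
  set g : Fin n → EuclideanSpace ℝ (Fin n) → ℝ := fun i y => vf15 u x₀ i (x₀ + R • y) with hg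
  have aff : ContDiff ℝ 1 (fun y : EuclideanSpace ℝ (Fin n) => x₀ + R • y) :=
    contDiff_const.add (contDiff_id.const_smul R)
  have hgc : ∀ i, ContDiff ℝ 1 (g i) := fun i => (contDiff_vf15 hu x₀ i).comp aff
  have hgd : ∀ i y v, fderiv ℝ (g i) y v = R * fderiv ℝ (vf15 u x₀ i) (x₀ + R • y) v := by
    intro i y v
    have h1 := ((contDiff_vf15 hu x₀ i).differentiable (by norm_num) (x₀ + R • y)).hasFDerivAt
    have h2 : HasFDerivAt (fun y : EuclideanSpace ℝ (Fin n) => x₀ + R • y) _ y :=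
      ((hasFDerivAt_id (𝕜 := ℝ) y).const_smul R).const_add x₀
    have h3 := HasFDerivAt.comp (g := vf15 u x₀ i) y h1 h2
    have h4 : fderiv ℝ (g i) y = _ := h3.fderiv
    rw [h4]
    simp
  have hb := fun i => ibp15 (contDiff_cut15 (n := n) k) (hgc i) (compact_cut15 k)
    (EuclideanSpace.single i 1)
  have e1 : ∀ y, cut15 k y * (2 * R * eDens15 u W (x₀ + R • y) +
      R ^ 2 * fderiv ℝ (eDens15 u W) (x₀ + R • y) y) =
      cut15 k y * (2 * R * W (u (x₀ + R • y))) +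
      ∑ i, cut15 k y * fderiv ℝ (g i) y (EuclideanSpace.single i 1) := by
    intro y
    have := ident15 hu hW hPDE x₀ (x₀ + R • y)
    simp only [add_sub_cancel_left, map_smul (fderiv ℝ (eDens15 u W) (x₀ + R • y)), smul_eq_mul] at this
    simp only [hgd, ← Finset.mul_sum]
    linear_combination (cut15 k y * R) * this
  have iW : Integrable (fun y : EuclideanSpace ℝ (Fin n) =>
      cut15 k y * (2 * R * W (u (x₀ + R • y)))) := by
    refine Continuous.integrable_of_hasCompactSupport ?_ (compact_cut15 k).mul_right
    exact (contDiff_cut15 k).continuous.mul (continuous_const.mul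
      (hW.continuous.comp (hu.continuous.comp aff.continuous)))
  simp_rw [e1]
  rw [integral_add iW (integrable_finsetSum _ fun i _ => (hb i).1),
    integral_finsetSum _ fun i _ => (hb i).1, Finset.sum_congr rfl fun i _ => (hb i).2.2,
    Finset.sum_neg_distrib, ← integral_finsetSum _ fun i _ => (hb i).2.1]
  have p1 : 0 ≤ ∫ y : EuclideanSpace ℝ (Fin n), cut15 k y * (2 * R * W (u (x₀ + R • y))) :=
    integral_nonneg fun y => mul_nonneg (Real.smoothTransition.nonneg _)
      (mul_nonneg (by positivity) (hWpos _))
  have p2 : ∫ y : EuclideanSpace ℝ (Fin n),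
      ∑ i, fderiv ℝ (cut15 k) y (EuclideanSpace.single i 1) * g i y ≤ 0 := by
    refine integral_nonpos fun y => ?_
    obtain ⟨c, hc, hcv⟩ := fderiv_cut15 k y
    have : ∑ i, fderiv ℝ (cut15 k) y (EuclideanSpace.single i 1) * g i y =
        c * R * ‖fderiv ℝ u (x₀ + R • y) y‖ ^ 2 := by
      rw [← real_inner_self_eq_norm_sq]
      nth_rw 2 [← sum_single15 (fderiv ℝ u (x₀ + R • y)) y]
      rw [inner_sum, Finset.mul_sum]
      refine Finset.sum_congr rfl fun i _ => ?_
      rw [hcv]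
      simp [hg, vf15, pd15, inner_smul_left, inner_smul_right, EuclideanSpace.inner_single_right]
      ring
    simp only [this, Pi.zero_apply]
    exact mul_nonpos_of_nonpos_of_nonneg (mul_nonpos_of_nonpos_of_nonneg hc hR.le) (sq_nonneg _)
  linarith

lemma deriv15 {n : ℕ} {e : EuclideanSpace ℝ (Fin n) → ℝ} (he : ContDiff ℝ 1 e)
    (x₀ : EuclideanSpace ℝ (Fin n)) (k : ℕ) (R : ℝ) :
    HasDerivAt (fun R : ℝ => ∫ y, cut15 k y * (R ^ 2 * e (x₀ + R • y)))
      (∫ y, cut15 k y * (2 * R * e (x₀ + R • y) + R ^ 2 * fderiv ℝ e (x₀ + R • y) y)) R := by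
  have cc : Continuous (cut15 (n := n) k) := (contDiff_cut15 k).continuous
  have ce := he.continuous
  have ce' := he.continuous_fderiv (by norm_num)
  set G : ℝ × EuclideanSpace ℝ (Fin n) → ℝ := fun p => cut15 k p.2 *
    (2 * p.1 * e (x₀ + p.1 • p.2) + p.1 ^ 2 * fderiv ℝ e (x₀ + p.1 • p.2) p.2) with hG
  have cG : Continuous G := by
    have : Continuous fun p : ℝ × EuclideanSpace ℝ (Fin n) =>
        fderiv ℝ e (x₀ + p.1 • p.2) p.2 :=
      (ce'.comp (by fun_prop)).clm_apply continuous_snd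
    rw [hG]
    fun_prop
  obtain ⟨C, hC⟩ := ((isCompact_closedBall R 1).prod
    (isCompact_closedBall (0 : EuclideanSpace ℝ (Fin n)) 1)).exists_bound_of_continuousOn
      cG.continuousOn
  refine (hasDerivAt_integral_of_dominated_loc_of_deriv_le (μ := volume)
    (F := fun R y => cut15 k y * (R ^ 2 * e (x₀ + R • y)))
    (F' := fun R y => G (R, y))
    (bound := (Metric.closedBall (0 : EuclideanSpace ℝ (Fin n)) 1).indicator fun _ => C)
    (Metric.closedBall_mem_nhds R one_pos) ?_ ?_ ?_ ?_ ?_ ?_).2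
  · refine Filter.Eventually.of_forall fun r => Continuous.aestronglyMeasurable ?_
    fun_prop
  · refine Continuous.integrable_of_hasCompactSupport ?_ (compact_cut15 k).mul_right
    fun_prop
  · exact Continuous.aestronglyMeasurable (cG.comp (by fun_prop))
  · refine Filter.Eventually.of_forall fun y r hr => ?_
    by_cases hy : y ∈ Metric.closedBall (0 : EuclideanSpace ℝ (Fin n)) 1
    · rw [Set.indicator_of_mem hy]
      exact hC (r, y) ⟨hr, hy⟩
    · rw [Set.indicator_of_notMem hy]
      simp at hy
      simp [hG, cut15_zero k hy.le]
  · rw [integrable_indicator_iff Metric.isClosed_closedBall.measurableSet]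
    exact integrableOn_const (isCompact_closedBall _ _).measure_lt_top.ne
  · refine Filter.Eventually.of_forall fun y r _ => ?_
    have h1 : HasDerivAt (fun r : ℝ => x₀ + r • y) y r := by
      simpa using ((hasDerivAt_id r).smul_const y).const_add x₀
    have h2 := (he.differentiable (by norm_num) (x₀ + r • y)).hasFDerivAt.comp_hasDerivAt r h1
    have h3 := ((hasDerivAt_pow 2 r).mul h2).const_mul (cut15 k y)
    have h4 : G (r, y) = cut15 k y * (((2 : ℕ) : ℝ) * r ^ (2 - 1) * e (x₀ + r • y) +
        r ^ 2 * fderiv ℝ e (x₀ + r • y) y) := by simp [hG]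
    simp only [h4]
    exact h3

lemma mono15 {n m : ℕ} {u : EuclideanSpace ℝ (Fin n) → EuclideanSpace ℝ (Fin m)}
    {W : EuclideanSpace ℝ (Fin m) → ℝ} (hu : ContDiff ℝ 2 u) (hW : ContDiff ℝ 2 W)
    (hWpos : ∀ y, 0 ≤ W y)
    (hPDE : ∀ x, ∑ i : Fin n, pd15 (fun y => pd15 u i y) i x = gradient W (u x))
    (x₀ : EuclideanSpace ℝ (Fin n)) (k : ℕ) :
    MonotoneOn (fun R : ℝ => ∫ y, cut15 k y * (R ^ 2 * eDens15 u W (x₀ + R • y)))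
      (Set.Ioi 0) := by
  have hd := deriv15 (contDiff_eDens15 hu hW) x₀ k
  refine monotoneOn_of_deriv_nonneg (convex_Ioi 0)
    (fun R _ => (hd R).continuousAt.continuousWithinAt)
    (fun R _ => (hd R).differentiableAt.differentiableWithinAt) fun R hR => ?_
  rw [interior_Ioi] at hR
  rw [(hd R).deriv]
  exact key15 hu hW hWpos hPDE x₀ k hR

lemma tendsto15 {n : ℕ} {f : EuclideanSpace ℝ (Fin n) → ℝ} (hf : Continuous f) :
    Filter.Tendsto (fun k : ℕ => ∫ y, cut15 k y * f y) Filter.atTop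
      (nhds (∫ y in Metric.ball 0 1, f y)) := by
  rw [← integral_indicator Metric.isOpen_ball.measurableSet]
  refine tendsto_integral_of_dominated_convergence
    ((Metric.closedBall 0 1).indicator fun y => |f y|) ?_ ?_ ?_ ?_
  · exact fun k => ((contDiff_cut15 k).continuous.mul hf).aestronglyMeasurable
  · rw [integrable_indicator_iff Metric.isClosed_closedBall.measurableSet]
    exact hf.abs.continuousOn.integrableOn_compact (isCompact_closedBall _ _)
  · refine fun k => Filter.Eventually.of_forall fun y => ?_
    by_cases hy : y ∈ Metric.closedBall (0 : EuclideanSpace ℝ (Fin n)) 1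
    · rw [Set.indicator_of_mem hy, norm_mul, Real.norm_eq_abs, Real.norm_eq_abs,
        abs_of_nonneg (show 0 ≤ cut15 k y from Real.smoothTransition.nonneg _)]
      exact mul_le_of_le_one_left (abs_nonneg _) (Real.smoothTransition.le_one _)
    · rw [Set.indicator_of_notMem hy]
      simp at hy
      simp [cut15_zero k hy.le]
  · refine Filter.Eventually.of_forall fun y => ?_
    by_cases hy : y ∈ Metric.ball (0 : EuclideanSpace ℝ (Fin n)) 1
    · rw [Set.indicator_of_mem hy]
      simp at hy
      have h1 : 0 < 1 - ‖y‖ ^ 2 := by nlinarith [norm_nonneg y]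
      refine tendsto_const_nhds.congr' ?_
      have := (tendsto_natCast_atTop_atTop (R := ℝ)).atTop_mul_const h1
      filter_upwards [this.eventually_ge_atTop 1] with k hk
      rw [cut15, Real.smoothTransition.one_of_one_le hk, one_mul]
    · rw [Set.indicator_of_notMem hy]
      simp at hy
      simp [cut15_zero _ hy]

lemma scale15 {n : ℕ} (e : EuclideanSpace ℝ (Fin n) → ℝ) (x₀ : EuclideanSpace ℝ (Fin n))
    {R : ℝ} (hR : 0 < R) :
    R ^ ((2:ℝ) - n) * ∫ x in Metric.ball x₀ R, e x =
      ∫ y in Metric.ball 0 1, R ^ 2 * e (x₀ + R • y) := by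
  rw [integral_const_mul,
    Measure.setIntegral_comp_smul_of_pos volume (fun z => e (x₀ + z)) (Metric.ball 0 1) hR,
    smul_unitBall_of_pos hR, finrank_euclideanSpace_fin]
  have h1 : ∫ x in Metric.ball x₀ R, e x = ∫ x in Metric.ball 0 R, e (x₀ + x) := by
    rw [← (measurePreserving_add_left volume x₀).setIntegral_preimage_emb
      (measurableEmbedding_addLeft x₀)]
    simp
  rw [h1, Real.rpow_sub hR, Real.rpow_natCast, Real.rpow_ofNat, smul_eq_mul]
  ring

/-- if `u : ℝⁿ → ℝᵐ` is a `C²` solution of `Δu = ∇W(u)` with `W ≥ 0`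
and `n ≥ 3`, then for every `x₀` the rescaled energy
`R ↦ R^{2−n} ∫_{B_R(x₀)} (½|∇u|² + W(u))` is monotone non-decreasing on `(0,∞)`. -/
theorem stmt_15 (n m : ℕ) (hn : 3 ≤ n)
    (u : EuclideanSpace ℝ (Fin n) → EuclideanSpace ℝ (Fin m))
    (W : EuclideanSpace ℝ (Fin m) → ℝ) (hu : ContDiff ℝ 2 u) (hW : ContDiff ℝ 2 W)
    (hWpos : ∀ y, 0 ≤ W y)
    (hPDE : ∀ x, ∑ i : Fin n, pd15 (fun y => pd15 u i y) i x = gradient W (u x))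
    (x₀ : EuclideanSpace ℝ (Fin n)) :
    MonotoneOn (fun R : ℝ => R ^ ((2:ℝ) - n) * ∫ x in Metric.ball x₀ R, eDens15 u W x)
      (Set.Ioi 0) := by
  have he := (contDiff_eDens15 hu hW).continuous
  intro a ha b hb hab
  simp only
  rw [scale15 _ x₀ ha, scale15 _ x₀ hb]
  have hc : ∀ R : ℝ, Continuous fun y => R ^ 2 * eDens15 u W (x₀ + R • y) := fun R => by fun_prop
  exact le_of_tendsto_of_tendsto' (tendsto15 (hc a)) (tendsto15 (hc b))
    fun k => mono15 hu hW hWpos hPDE x₀ k ha hb hab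

end
end

section
/- Let P → ℝⁿ be a trivial principal G-bundle (G compact semisimple), E the adjoint bundle, and (A, u) a smooth Yang–Mills–Higgs pair on ℝⁿ with n > 4: δ^∇ F_A + u ⊙ d^∇ u = 0 and δ^∇ d^∇ u + 2W'(|u|²)u = 0, with W ≥ 0. Then R ↦ R^{4−n} ∫_{B_R(x₀)} ((1/2)|F_A|² + (1/2)|d^∇u|² + W(|u|²)) dx is monotone non-decreasing in R > 0 for every x₀. -/
open MeasureTheory Set
open scoped RealInnerProductSpace

noncomputable section

section YMH

variable {n : ℕ} {G V : Type*}
  [NormedAddCommGroup G] [InnerProductSpace ℝ G] [FiniteDimensional ℝ G]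
  [NormedAddCommGroup V] [InnerProductSpace ℝ V] [FiniteDimensional ℝ V]

/-- coordinate partial derivative on `ℝⁿ`. -/
def pd17 {F : Type*} [NormedAddCommGroup F] [NormedSpace ℝ F]
    (f : EuclideanSpace ℝ (Fin n) → F) (i : Fin n) (x : EuclideanSpace ℝ (Fin n)) : F :=
  fderiv ℝ f x (EuclideanSpace.single i 1)

/-- curvature `F_{ij} = ∂ᵢAⱼ − ∂ⱼAᵢ + [Aᵢ, Aⱼ]` of the connection with (global,
trivial-bundle) connection form components `A i : ℝⁿ → 𝔤`. -/
def curv17 (br : G →ₗ[ℝ] G →ₗ[ℝ] G) (A : EuclideanSpace ℝ (Fin n) → Fin n → G)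
    (x : EuclideanSpace ℝ (Fin n)) (i j : Fin n) : G :=
  pd17 (fun y => A y j) i x - pd17 (fun y => A y i) j x + br (A x i) (A x j)

/-- covariant derivative `(d^∇u)_i = ∂ᵢu + ρ(Aᵢ)u` of the Higgs field. -/
def covD17 (ρ : G →ₗ[ℝ] V →ₗ[ℝ] V) (A : EuclideanSpace ℝ (Fin n) → Fin n → G)
    (u : EuclideanSpace ℝ (Fin n) → V) (x : EuclideanSpace ℝ (Fin n)) (i : Fin n) : V :=
  pd17 u i x + ρ (A x i) (u x)

/-- Yang–Mills–Higgs energy density `ẽ = ½|F_A|² + ½|d^∇u|² + W(|u|²)`, with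
`|F_A|² = ½ Σ_{i,j} ‖F_{ij}‖²` and `|d^∇u|² = Σᵢ ‖(d^∇u)ᵢ‖²`. -/
def eYMH17 (br : G →ₗ[ℝ] G →ₗ[ℝ] G) (ρ : G →ₗ[ℝ] V →ₗ[ℝ] V)
    (A : EuclideanSpace ℝ (Fin n) → Fin n → G) (u : EuclideanSpace ℝ (Fin n) → V)
    (W : ℝ → ℝ) (x : EuclideanSpace ℝ (Fin n)) : ℝ :=
  (1 / 4) * ∑ i : Fin n, ∑ j : Fin n, ‖curv17 br A x i j‖ ^ 2
    + (1 / 2) * ∑ i : Fin n, ‖covD17 ρ A u x i‖ ^ 2 + W (‖u x‖ ^ 2)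

/-- first Yang–Mills–Higgs equation `δ^∇F_A + u ⊙ d^∇u = 0`, written by pairing with
an arbitrary `X ∈ 𝔤` using `⟨X, e₁ ⊙ e₂⟩ = ⟨ρ(X)e₁, e₂⟩`; here
`(δ^∇F)_j = −Σᵢ(∂ᵢF_{ij} + [Aᵢ, F_{ij}])`. -/
def YMH1 (br : G →ₗ[ℝ] G →ₗ[ℝ] G) (ρ : G →ₗ[ℝ] V →ₗ[ℝ] V)
    (A : EuclideanSpace ℝ (Fin n) → Fin n → G) (u : EuclideanSpace ℝ (Fin n) → V) : Prop :=
  ∀ (x : EuclideanSpace ℝ (Fin n)) (j : Fin n) (X : G),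
    ⟪X, -∑ i : Fin n,
        (pd17 (fun y => curv17 br A y i j) i x + br (A x i) (curv17 br A x i j))⟫
      + ⟪ρ X (u x), covD17 ρ A u x j⟫ = 0

/-- second Yang–Mills–Higgs equation `δ^∇d^∇u + 2W'(|u|²)u = 0`, with
`δ^∇η = −Σᵢ(∂ᵢηᵢ + ρ(Aᵢ)ηᵢ)` for a `V`-valued 1-form `η`. -/
def YMH2 (ρ : G →ₗ[ℝ] V →ₗ[ℝ] V) (A : EuclideanSpace ℝ (Fin n) → Fin n → G)
    (u : EuclideanSpace ℝ (Fin n) → V) (W : ℝ → ℝ) : Prop :=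
  ∀ x : EuclideanSpace ℝ (Fin n),
    (-∑ i : Fin n, (pd17 (fun y => covD17 ρ A u y i) i x + ρ (A x i) (covD17 ρ A u x i)))
      + (2 * deriv W (‖u x‖ ^ 2)) • u x = 0

theorem pd17_smooth {F : Type*} [NormedAddCommGroup F] [NormedSpace ℝ F]
    {f : EuclideanSpace ℝ (Fin n) → F} (hf : ContDiff ℝ (⊤ : ℕ∞) f) (i : Fin n) :
    ContDiff ℝ (⊤ : ℕ∞) (pd17 f i) := by
  have h : ContDiff ℝ (⊤ : ℕ∞) (fderiv ℝ f) := hf.fderiv_right (by simp)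
  exact h.clm_apply contDiff_const

theorem smooth_diff17 {F : Type*} [NormedAddCommGroup F] [NormedSpace ℝ F]
    {f : EuclideanSpace ℝ (Fin n) → F} (hf : ContDiff ℝ (⊤ : ℕ∞) f)
    (x : EuclideanSpace ℝ (Fin n)) : DifferentiableAt ℝ f x :=
  (hf.differentiable (by simp)) x

theorem pd17_add {F : Type*} [NormedAddCommGroup F] [NormedSpace ℝ F]
    {f g : EuclideanSpace ℝ (Fin n) → F} (hf : ContDiff ℝ (⊤ : ℕ∞) f)
    (hg : ContDiff ℝ (⊤ : ℕ∞) g) (i : Fin n) (x : EuclideanSpace ℝ (Fin n)) :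
    pd17 (fun y => f y + g y) i x = pd17 f i x + pd17 g i x := by
  unfold pd17
  rw [fderiv_fun_add (smooth_diff17 hf x) (smooth_diff17 hg x)]
  rfl

theorem pd17_sub {F : Type*} [NormedAddCommGroup F] [NormedSpace ℝ F]
    {f g : EuclideanSpace ℝ (Fin n) → F} (hf : ContDiff ℝ (⊤ : ℕ∞) f)
    (hg : ContDiff ℝ (⊤ : ℕ∞) g) (i : Fin n) (x : EuclideanSpace ℝ (Fin n)) :
    pd17 (fun y => f y - g y) i x = pd17 f i x - pd17 g i x := by
  unfold pd17
  rw [fderiv_fun_sub (smooth_diff17 hf x) (smooth_diff17 hg x)]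
  rfl

theorem pd17_sum {F : Type*} [NormedAddCommGroup F] [NormedSpace ℝ F] {ι : Type*} [Fintype ι]
    {f : ι → EuclideanSpace ℝ (Fin n) → F} (hf : ∀ k, ContDiff ℝ (⊤ : ℕ∞) (f k))
    (i : Fin n) (x : EuclideanSpace ℝ (Fin n)) :
    pd17 (fun y => ∑ k, f k y) i x = ∑ k, pd17 (f k) i x := by
  unfold pd17
  rw [fderiv_fun_sum (fun k _ => smooth_diff17 (hf k) x)]
  simp

theorem pd17_inner {F : Type*} [NormedAddCommGroup F] [InnerProductSpace ℝ F]
    {f g : EuclideanSpace ℝ (Fin n) → F} (hf : ContDiff ℝ (⊤ : ℕ∞) f)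
    (hg : ContDiff ℝ (⊤ : ℕ∞) g) (i : Fin n) (x : EuclideanSpace ℝ (Fin n)) :
    pd17 (fun y => ⟪f y, g y⟫) i x = ⟪pd17 f i x, g x⟫ + ⟪f x, pd17 g i x⟫ := by
  unfold pd17
  rw [fderiv_inner_apply ℝ (smooth_diff17 hf x) (smooth_diff17 hg x)]
  ring

theorem pd17_mul
    {f g : EuclideanSpace ℝ (Fin n) → ℝ} (hf : ContDiff ℝ (⊤ : ℕ∞) f)
    (hg : ContDiff ℝ (⊤ : ℕ∞) g) (i : Fin n) (x : EuclideanSpace ℝ (Fin n)) :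
    pd17 (fun y => f y * g y) i x = pd17 f i x * g x + f x * pd17 g i x := by
  unfold pd17
  rw [fderiv_fun_mul (smooth_diff17 hf x) (smooth_diff17 hg x)]
  simp; ring

theorem bilin_smooth17 {F H K : Type*} [NormedAddCommGroup F] [NormedSpace ℝ F]
    [FiniteDimensional ℝ F] [NormedAddCommGroup H] [NormedSpace ℝ H] [FiniteDimensional ℝ H]
    [NormedAddCommGroup K] [NormedSpace ℝ K] [FiniteDimensional ℝ K]
    (B : F →ₗ[ℝ] H →ₗ[ℝ] K)
    {f : EuclideanSpace ℝ (Fin n) → F} {g : EuclideanSpace ℝ (Fin n) → H}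
    (hf : ContDiff ℝ (⊤ : ℕ∞) f) (hg : ContDiff ℝ (⊤ : ℕ∞) g) :
    ContDiff ℝ (⊤ : ℕ∞) (fun y => B (f y) (g y)) := by
  have : ContDiff ℝ (⊤ : ℕ∞) (fun y => B.toContinuousBilinearMap (f y) (g y)) :=
    (B.toContinuousBilinearMap.contDiff.comp hf).clm_apply hg
  exact this

theorem pd17_bilin {F H K : Type*} [NormedAddCommGroup F] [NormedSpace ℝ F]
    [FiniteDimensional ℝ F] [NormedAddCommGroup H] [NormedSpace ℝ H] [FiniteDimensional ℝ H]
    [NormedAddCommGroup K] [NormedSpace ℝ K] [FiniteDimensional ℝ K]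
    (B : F →ₗ[ℝ] H →ₗ[ℝ] K)
    {f : EuclideanSpace ℝ (Fin n) → F} {g : EuclideanSpace ℝ (Fin n) → H}
    (hf : ContDiff ℝ (⊤ : ℕ∞) f) (hg : ContDiff ℝ (⊤ : ℕ∞) g)
    (i : Fin n) (x : EuclideanSpace ℝ (Fin n)) :
    pd17 (fun y => B (f y) (g y)) i x = B (pd17 f i x) (g x) + B (f x) (pd17 g i x) := by
  have h := (B.toContinuousBilinearMap.hasFDerivAt_of_bilinear
    (smooth_diff17 hf x).hasFDerivAt (smooth_diff17 hg x).hasFDerivAt).fderiv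
  unfold pd17
  change fderiv ℝ (fun y => B.toContinuousBilinearMap (f y) (g y)) x _ = _
  rw [h]
  simp [ContinuousLinearMap.precompR, ContinuousLinearMap.precompL]
  abel

theorem pd17_comm {F : Type*} [NormedAddCommGroup F] [NormedSpace ℝ F]
    {f : EuclideanSpace ℝ (Fin n) → F} (hf : ContDiff ℝ (⊤ : ℕ∞) f) (i j : Fin n)
    (x : EuclideanSpace ℝ (Fin n)) :
    pd17 (pd17 f i) j x = pd17 (pd17 f j) i x := by
  have h : ContDiff ℝ (⊤ : ℕ∞) (fderiv ℝ f) := hf.fderiv_right (by simp)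
  have hs : IsSymmSndFDerivAt ℝ f x :=
    hf.contDiffAt.isSymmSndFDerivAt (by
      rw [minSmoothness_of_isRCLikeNormedField]
      exact (WithTop.coe_le_coe.2 le_top : ((2 : ℕ∞) : WithTop ℕ∞) ≤ ((⊤ : ℕ∞) : WithTop ℕ∞)))
  have key : ∀ a b : Fin n, pd17 (pd17 f a) b x =
      fderiv ℝ (fderiv ℝ f) x (EuclideanSpace.single b 1) (EuclideanSpace.single a 1) := by
    intro a b
    have h' : DifferentiableAt ℝ (fderiv ℝ f) x := (h.differentiable (by simp)) x
    change fderiv ℝ (fun y => fderiv ℝ f y (EuclideanSpace.single a 1)) x _ = _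
    rw [fderiv_clm_apply h' (differentiableAt_const _)]
    simp
  rw [key, key, hs.eq]

theorem curv_smooth17 (br : G →ₗ[ℝ] G →ₗ[ℝ] G) {A : EuclideanSpace ℝ (Fin n) → Fin n → G}
    (hA : ∀ i, ContDiff ℝ (⊤ : ℕ∞) (fun x => A x i)) (i j : Fin n) :
    ContDiff ℝ (⊤ : ℕ∞) (fun y => curv17 br A y i j) :=
  ((pd17_smooth (hA j) i).sub (pd17_smooth (hA i) j)).add (bilin_smooth17 br (hA i) (hA j))

theorem covD_smooth17 (ρ : G →ₗ[ℝ] V →ₗ[ℝ] V) {A : EuclideanSpace ℝ (Fin n) → Fin n → G}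
    {u : EuclideanSpace ℝ (Fin n) → V}
    (hA : ∀ i, ContDiff ℝ (⊤ : ℕ∞) (fun x => A x i)) (hu : ContDiff ℝ (⊤ : ℕ∞) u) (i : Fin n) :
    ContDiff ℝ (⊤ : ℕ∞) (fun y => covD17 ρ A u y i) :=
  (pd17_smooth hu i).add (bilin_smooth17 ρ (hA i) hu)

theorem pd_curv17 (br : G →ₗ[ℝ] G →ₗ[ℝ] G) {A : EuclideanSpace ℝ (Fin n) → Fin n → G}
    (hA : ∀ i, ContDiff ℝ (⊤ : ℕ∞) (fun x => A x i)) (k i j : Fin n)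
    (x : EuclideanSpace ℝ (Fin n)) :
    pd17 (fun y => curv17 br A y i j) k x =
      pd17 (pd17 (fun y => A y j) i) k x - pd17 (pd17 (fun y => A y i) j) k x
      + (br (pd17 (fun y => A y i) k x) (A x j) + br (A x i) (pd17 (fun y => A y j) k x)) := by
  unfold curv17
  rw [pd17_add ((pd17_smooth (hA j) i).sub (pd17_smooth (hA i) j))
    (bilin_smooth17 br (hA i) (hA j)), pd17_bilin br (hA i) (hA j)]
  congr 1
  exact pd17_sub (pd17_smooth (hA j) i) (pd17_smooth (hA i) j) k x

/-- covariant derivative of the curvature -/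
def nF17 (br : G →ₗ[ℝ] G →ₗ[ℝ] G) (A : EuclideanSpace ℝ (Fin n) → Fin n → G)
    (x : EuclideanSpace ℝ (Fin n)) (k i j : Fin n) : G :=
  pd17 (fun y => curv17 br A y i j) k x + br (A x k) (curv17 br A x i j)

/-- second covariant derivative of the Higgs field -/
def nD17 (ρ : G →ₗ[ℝ] V →ₗ[ℝ] V) (A : EuclideanSpace ℝ (Fin n) → Fin n → G)
    (u : EuclideanSpace ℝ (Fin n) → V) (x : EuclideanSpace ℝ (Fin n)) (k i : Fin n) : V :=
  pd17 (fun y => covD17 ρ A u y i) k x + ρ (A x k) (covD17 ρ A u x i)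

theorem bianchi17 (br : G →ₗ[ℝ] G →ₗ[ℝ] G)
    (hbr_skew : ∀ X Y : G, br X Y = -br Y X)
    (hjacobi : ∀ X Y Z : G, br X (br Y Z) = br (br X Y) Z + br Y (br X Z))
    {A : EuclideanSpace ℝ (Fin n) → Fin n → G}
    (hA : ∀ i, ContDiff ℝ (⊤ : ℕ∞) (fun x => A x i)) (x : EuclideanSpace ℝ (Fin n))
    (i j k : Fin n) :
    nF17 br A x i j k + nF17 br A x j k i + nF17 br A x k i j = 0 := by
  unfold nF17
  rw [pd_curv17 br hA, pd_curv17 br hA, pd_curv17 br hA]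
  unfold curv17
  simp only [map_add, map_sub]
  rw [pd17_comm (hA k) j i, pd17_comm (hA i) k j, pd17_comm (hA j) i k]
  have e1 := hbr_skew (A x i) (pd17 (fun y => A y j) k x)
  have e2 := hbr_skew (A x i) (pd17 (fun y => A y k) j x)
  have e3 := hbr_skew (A x j) (pd17 (fun y => A y i) k x)
  have e4 := hbr_skew (A x j) (pd17 (fun y => A y k) i x)
  have e5 := hbr_skew (A x k) (pd17 (fun y => A y i) j x)
  have e6 := hbr_skew (A x k) (pd17 (fun y => A y j) i x)
  have j1 := hjacobi (A x i) (A x j) (A x k)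
  have j2 := hbr_skew (br (A x i) (A x j)) (A x k)
  have j3 : br (A x j) (br (A x k) (A x i)) = - br (A x j) (br (A x i) (A x k)) := by
    rw [hbr_skew (A x k) (A x i), map_neg]
  rw [e1, e2, e3, e4, e5, e6, j1, j2, j3]
  abel

theorem curv_skew17 (br : G →ₗ[ℝ] G →ₗ[ℝ] G)
    (hbr_skew : ∀ X Y : G, br X Y = -br Y X)
    (A : EuclideanSpace ℝ (Fin n) → Fin n → G) (x : EuclideanSpace ℝ (Fin n))
    (i j : Fin n) : curv17 br A x i j = - curv17 br A x j i := by
  unfold curv17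
  rw [hbr_skew (A x i) (A x j)]
  abel

theorem nF_skew17 (br : G →ₗ[ℝ] G →ₗ[ℝ] G)
    (hbr_skew : ∀ X Y : G, br X Y = -br Y X)
    (A : EuclideanSpace ℝ (Fin n) → Fin n → G) (x : EuclideanSpace ℝ (Fin n))
    (k i j : Fin n) : nF17 br A x k i j = - nF17 br A x k j i := by
  unfold nF17
  have h : (fun y => curv17 br A y i j) = fun y => - curv17 br A y j i := by
    funext y; exact curv_skew17 br hbr_skew A y i j
  have h2 : pd17 (fun y => curv17 br A y i j) k x = - pd17 (fun y => curv17 br A y j i) k x := by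
    rw [h]; unfold pd17; rw [fderiv_fun_neg]; rfl
  rw [h2, curv_skew17 br hbr_skew A x i j, map_neg]
  abel

theorem nD_comm17 (br : G →ₗ[ℝ] G →ₗ[ℝ] G) (ρ : G →ₗ[ℝ] V →ₗ[ℝ] V)
    (hρ_lie : ∀ X Y : G, ∀ v : V, ρ (br X Y) v = ρ X (ρ Y v) - ρ Y (ρ X v))
    {A : EuclideanSpace ℝ (Fin n) → Fin n → G} {u : EuclideanSpace ℝ (Fin n) → V}
    (hA : ∀ i, ContDiff ℝ (⊤ : ℕ∞) (fun x => A x i)) (hu : ContDiff ℝ (⊤ : ℕ∞) u)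
    (x : EuclideanSpace ℝ (Fin n)) (i j : Fin n) :
    nD17 ρ A u x i j = nD17 ρ A u x j i + ρ (curv17 br A x i j) (u x) := by
  have key : ∀ a b, pd17 (fun y => covD17 ρ A u y a) b x = pd17 (pd17 u a) b x +
      (ρ (pd17 (fun y => A y a) b x) (u x) + ρ (A x a) (pd17 u b x)) := by
    intro a b
    unfold covD17
    rw [pd17_add (pd17_smooth hu a) (bilin_smooth17 ρ (hA a) hu), pd17_bilin ρ (hA a) hu]
  unfold nD17
  rw [key, key, pd17_comm hu j i]
  unfold covD17 curv17
  simp only [map_add, map_sub, LinearMap.add_apply, LinearMap.sub_apply, hρ_lie]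
  abel

/-- The nonnegative part of the stress-energy tensor. -/
def S17 (br : G →ₗ[ℝ] G →ₗ[ℝ] G) (ρ : G →ₗ[ℝ] V →ₗ[ℝ] V)
    (A : EuclideanSpace ℝ (Fin n) → Fin n → G) (u : EuclideanSpace ℝ (Fin n) → V)
    (x : EuclideanSpace ℝ (Fin n)) (i j : Fin n) : ℝ :=
  ∑ k : Fin n, ⟪curv17 br A x i k, curv17 br A x j k⟫ + ⟪covD17 ρ A u x i, covD17 ρ A u x j⟫

theorem S_smooth17 (br : G →ₗ[ℝ] G →ₗ[ℝ] G) (ρ : G →ₗ[ℝ] V →ₗ[ℝ] V)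
    {A : EuclideanSpace ℝ (Fin n) → Fin n → G} {u : EuclideanSpace ℝ (Fin n) → V}
    (hA : ∀ i, ContDiff ℝ (⊤ : ℕ∞) (fun x => A x i)) (hu : ContDiff ℝ (⊤ : ℕ∞) u)
    (i j : Fin n) : ContDiff ℝ (⊤ : ℕ∞) (fun y => S17 br ρ A u y i j) :=
  (ContDiff.sum fun k _ => (curv_smooth17 br hA i k).inner ℝ (curv_smooth17 br hA j k)).add
    ((covD_smooth17 ρ hA hu i).inner ℝ (covD_smooth17 ρ hA hu j))

theorem e_smooth17 (br : G →ₗ[ℝ] G →ₗ[ℝ] G) (ρ : G →ₗ[ℝ] V →ₗ[ℝ] V)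
    {A : EuclideanSpace ℝ (Fin n) → Fin n → G} {u : EuclideanSpace ℝ (Fin n) → V} {W : ℝ → ℝ}
    (hA : ∀ i, ContDiff ℝ (⊤ : ℕ∞) (fun x => A x i)) (hu : ContDiff ℝ (⊤ : ℕ∞) u)
    (hW : ContDiff ℝ (⊤ : ℕ∞) W) : ContDiff ℝ (⊤ : ℕ∞) (eYMH17 br ρ A u W) :=
  ((contDiff_const.mul (ContDiff.sum fun i _ => ContDiff.sum fun j _ =>
      (curv_smooth17 br hA i j).norm_sq ℝ)).add
    (contDiff_const.mul (ContDiff.sum fun i _ => (covD_smooth17 ρ hA hu i).norm_sq ℝ))).add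
    (hW.comp (hu.norm_sq ℝ))

theorem pd_e17 (br : G →ₗ[ℝ] G →ₗ[ℝ] G) (ρ : G →ₗ[ℝ] V →ₗ[ℝ] V)
    (hbr_inv : ∀ X Y Z : G, ⟪br X Y, Z⟫ = -⟪Y, br X Z⟫)
    (hρ_skew : ∀ (X : G) (v w : V), ⟪ρ X v, w⟫ = -⟪v, ρ X w⟫)
    {A : EuclideanSpace ℝ (Fin n) → Fin n → G} {u : EuclideanSpace ℝ (Fin n) → V} {W : ℝ → ℝ}
    (hA : ∀ i, ContDiff ℝ (⊤ : ℕ∞) (fun x => A x i)) (hu : ContDiff ℝ (⊤ : ℕ∞) u)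
    (hW : ContDiff ℝ (⊤ : ℕ∞) W) (x : EuclideanSpace ℝ (Fin n)) (j : Fin n) :
    pd17 (eYMH17 br ρ A u W) j x =
      (1 / 2) * ∑ i, ∑ k, ⟪curv17 br A x i k, nF17 br A x j i k⟫
      + ∑ i, ⟪covD17 ρ A u x i, nD17 ρ A u x j i⟫
      + 2 * deriv W (‖u x‖ ^ 2) * ⟪u x, covD17 ρ A u x j⟫ := by
  have hF : ∀ i k, pd17 (fun y => ‖curv17 br A y i k‖ ^ 2) j x =
      2 * ⟪curv17 br A x i k, nF17 br A x j i k⟫ := by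
    intro i k
    simp only [← real_inner_self_eq_norm_sq]
    rw [pd17_inner (curv_smooth17 br hA i k) (curv_smooth17 br hA i k)]
    unfold nF17
    rw [inner_add_right, real_inner_comm (curv17 br A x i k)]
    have := hbr_inv (A x j) (curv17 br A x i k) (curv17 br A x i k)
    rw [real_inner_comm] at this
    linarith
  have hD : ∀ i, pd17 (fun y => ‖covD17 ρ A u y i‖ ^ 2) j x =
      2 * ⟪covD17 ρ A u x i, nD17 ρ A u x j i⟫ := by
    intro i
    simp only [← real_inner_self_eq_norm_sq]
    rw [pd17_inner (covD_smooth17 ρ hA hu i) (covD_smooth17 ρ hA hu i)]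
    unfold nD17
    rw [inner_add_right, real_inner_comm (covD17 ρ A u x i)]
    have := hρ_skew (A x j) (covD17 ρ A u x i) (covD17 ρ A u x i)
    rw [real_inner_comm] at this
    linarith
  have hu2 : pd17 (fun y => ‖u y‖ ^ 2) j x = 2 * ⟪u x, covD17 ρ A u x j⟫ := by
    simp only [← real_inner_self_eq_norm_sq]
    rw [pd17_inner hu hu]
    unfold covD17
    rw [inner_add_right, real_inner_comm (u x)]
    have := hρ_skew (A x j) (u x) (u x)
    rw [real_inner_comm] at this
    linarith
  have hWd : pd17 (fun y => W (‖u y‖ ^ 2)) j x =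
      deriv W (‖u x‖ ^ 2) * pd17 (fun y => ‖u y‖ ^ 2) j x := by
    have h1 : HasDerivAt W (deriv W (‖u x‖ ^ 2)) (‖u x‖ ^ 2) :=
      ((hW.differentiable (by simp)) _).hasDerivAt
    have h2 := (smooth_diff17 (hu.norm_sq ℝ) x).hasFDerivAt
    have h3 := (h1.comp_hasFDerivAt x h2).fderiv
    unfold pd17
    have h4 : (fun y => W (‖u y‖ ^ 2)) = W ∘ (fun y => ‖u y‖ ^ 2) := rfl
    rw [h4, h3]
    simp
  have s1 : ∀ i, ContDiff ℝ (⊤ : ℕ∞) (fun y => ∑ k, ‖curv17 br A y i k‖ ^ 2) := fun i =>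
    ContDiff.sum fun k _ => (curv_smooth17 br hA i k).norm_sq ℝ
  have s2 : ContDiff ℝ (⊤ : ℕ∞) (fun y => ∑ i, ∑ k, ‖curv17 br A y i k‖ ^ 2) :=
    ContDiff.sum fun i _ => s1 i
  have s3 : ContDiff ℝ (⊤ : ℕ∞) (fun y => ∑ i, ‖covD17 ρ A u y i‖ ^ 2) :=
    ContDiff.sum fun i _ => (covD_smooth17 ρ hA hu i).norm_sq ℝ
  have s4 : ContDiff ℝ (⊤ : ℕ∞) (fun y => W (‖u y‖ ^ 2)) := hW.comp (hu.norm_sq ℝ)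
  have hc : ∀ c : ℝ, pd17 (fun _ : EuclideanSpace ℝ (Fin n) => c) j x = 0 := by
    intro c; simp [pd17]
  change pd17 (fun y => (1 / 4) * ∑ i : Fin n, ∑ j : Fin n, ‖curv17 br A y i j‖ ^ 2
    + (1 / 2) * ∑ i : Fin n, ‖covD17 ρ A u y i‖ ^ 2 + W (‖u y‖ ^ 2)) j x = _
  rw [pd17_add ((contDiff_const.mul s2).add (contDiff_const.mul s3)) s4,
    pd17_add (contDiff_const.mul s2) (contDiff_const.mul s3),
    pd17_mul contDiff_const s2, pd17_mul contDiff_const s3, hc, hc, pd17_sum s1,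
    pd17_sum (fun i => (covD_smooth17 ρ hA hu i).norm_sq ℝ), hWd, hu2]
  simp only [hD]
  have : ∀ i, pd17 (fun y => ∑ k, ‖curv17 br A y i k‖ ^ 2) j x =
      2 * ∑ k, ⟪curv17 br A x i k, nF17 br A x j i k⟫ := by
    intro i
    rw [pd17_sum (fun k => (curv_smooth17 br hA i k).norm_sq ℝ), Finset.mul_sum]
    simp only [hF]
  simp only [this, ← Finset.mul_sum]
  ring

theorem pd_S17 (br : G →ₗ[ℝ] G →ₗ[ℝ] G) (ρ : G →ₗ[ℝ] V →ₗ[ℝ] V)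
    (hbr_inv : ∀ X Y Z : G, ⟪br X Y, Z⟫ = -⟪Y, br X Z⟫)
    (hρ_skew : ∀ (X : G) (v w : V), ⟪ρ X v, w⟫ = -⟪v, ρ X w⟫)
    {A : EuclideanSpace ℝ (Fin n) → Fin n → G} {u : EuclideanSpace ℝ (Fin n) → V}
    (hA : ∀ i, ContDiff ℝ (⊤ : ℕ∞) (fun x => A x i)) (hu : ContDiff ℝ (⊤ : ℕ∞) u)
    (x : EuclideanSpace ℝ (Fin n)) (l i j : Fin n) :
    pd17 (fun y => S17 br ρ A u y i j) l x =
      ∑ k, (⟪nF17 br A x l i k, curv17 br A x j k⟫ + ⟪curv17 br A x i k, nF17 br A x l j k⟫)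
      + (⟪nD17 ρ A u x l i, covD17 ρ A u x j⟫ + ⟪covD17 ρ A u x i, nD17 ρ A u x l j⟫) := by
  unfold S17
  rw [pd17_add (ContDiff.sum fun k _ => (curv_smooth17 br hA i k).inner ℝ (curv_smooth17 br hA j k))
    ((covD_smooth17 ρ hA hu i).inner ℝ (covD_smooth17 ρ hA hu j)),
    pd17_sum (fun k => (curv_smooth17 br hA i k).inner ℝ (curv_smooth17 br hA j k)),
    pd17_inner (covD_smooth17 ρ hA hu i) (covD_smooth17 ρ hA hu j)]
  congr 1
  · refine Finset.sum_congr rfl fun k _ => ?_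
    rw [pd17_inner (curv_smooth17 br hA i k) (curv_smooth17 br hA j k)]
    unfold nF17
    rw [inner_add_left, inner_add_right, hbr_inv]
    ring
  · unfold nD17
    rw [inner_add_left, inner_add_right, hρ_skew]
    ring

theorem div_S17 (br : G →ₗ[ℝ] G →ₗ[ℝ] G) (ρ : G →ₗ[ℝ] V →ₗ[ℝ] V)
    (hbr_skew : ∀ X Y : G, br X Y = -br Y X)
    (hjacobi : ∀ X Y Z : G, br X (br Y Z) = br (br X Y) Z + br Y (br X Z))
    (hbr_inv : ∀ X Y Z : G, ⟪br X Y, Z⟫ = -⟪Y, br X Z⟫)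
    (hρ_lie : ∀ X Y : G, ∀ v : V, ρ (br X Y) v = ρ X (ρ Y v) - ρ Y (ρ X v))
    (hρ_skew : ∀ (X : G) (v w : V), ⟪ρ X v, w⟫ = -⟪v, ρ X w⟫)
    {A : EuclideanSpace ℝ (Fin n) → Fin n → G} {u : EuclideanSpace ℝ (Fin n) → V} {W : ℝ → ℝ}
    (hA : ∀ i, ContDiff ℝ (⊤ : ℕ∞) (fun x => A x i)) (hu : ContDiff ℝ (⊤ : ℕ∞) u)
    (hW : ContDiff ℝ (⊤ : ℕ∞) W) (h1 : YMH1 br ρ A u) (h2 : YMH2 ρ A u W)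
    (x : EuclideanSpace ℝ (Fin n)) (j : Fin n) :
    ∑ i, pd17 (fun y => S17 br ρ A u y i j) i x = pd17 (eYMH17 br ρ A u W) j x := by
  rw [pd_e17 br ρ hbr_inv hρ_skew hA hu hW]
  simp only [pd_S17 br ρ hbr_inv hρ_skew hA hu, Finset.sum_add_distrib]
  -- first term
  have t1 : ∑ i, ∑ k, ⟪nF17 br A x i i k, curv17 br A x j k⟫ =
      ∑ k, ⟪ρ (curv17 br A x j k) (u x), covD17 ρ A u x k⟫ := by
    rw [Finset.sum_comm]
    refine Finset.sum_congr rfl fun k _ => ?_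
    have h := h1 x k (curv17 br A x j k)
    rw [inner_neg_right] at h
    rw [← sum_inner, real_inner_comm]
    change -⟪curv17 br A x j k, ∑ i, nF17 br A x i i k⟫ + _ = 0 at h
    linarith
  have t3 : ∑ i, ⟪nD17 ρ A u x i i, covD17 ρ A u x j⟫ =
      2 * deriv W (‖u x‖ ^ 2) * ⟪u x, covD17 ρ A u x j⟫ := by
    have h := h2 x
    change -(∑ i, nD17 ρ A u x i i) + _ = 0 at h
    rw [← sum_inner, neg_add_eq_zero.1 h, real_inner_smul_left]
  have t4 : ∑ i, ⟪covD17 ρ A u x i, nD17 ρ A u x i j⟫ =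
      ∑ i, ⟪covD17 ρ A u x i, nD17 ρ A u x j i⟫
        - ∑ k, ⟪ρ (curv17 br A x j k) (u x), covD17 ρ A u x k⟫ := by
    rw [← Finset.sum_sub_distrib]
    refine Finset.sum_congr rfl fun i _ => ?_
    rw [nD_comm17 br ρ hρ_lie hA hu x i j, curv_skew17 br hbr_skew A x i j, map_neg,
      inner_add_right, real_inner_comm (covD17 ρ A u x i) (ρ _ _), LinearMap.neg_apply,
      inner_neg_right]
    ring
  have t2 : 2 * ∑ i, ∑ k, ⟪curv17 br A x i k, nF17 br A x i j k⟫ =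
      ∑ i, ∑ k, ⟪curv17 br A x i k, nF17 br A x j i k⟫ := by
    have hswap : ∑ i, ∑ k, ⟪curv17 br A x i k, nF17 br A x i j k⟫ =
        ∑ i, ∑ k, ⟪curv17 br A x i k, nF17 br A x k i j⟫ := by
      rw [Finset.sum_comm]
      refine Finset.sum_congr rfl fun i _ => Finset.sum_congr rfl fun k _ => ?_
      rw [curv_skew17 br hbr_skew A x k i, nF_skew17 br hbr_skew A x k j i, inner_neg_neg]
    rw [two_mul]
    nth_rewrite 2 [hswap]
    rw [← Finset.sum_add_distrib]
    refine Finset.sum_congr rfl fun i _ => ?_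
    rw [← Finset.sum_add_distrib]
    refine Finset.sum_congr rfl fun k _ => ?_
    have hb := bianchi17 br hbr_skew hjacobi hA x i j k
    rw [nF_skew17 br hbr_skew A x j k i] at hb
    rw [← inner_add_right]
    congr 1
    rw [← sub_eq_zero, ← hb]
    abel
  rw [t1, t3, t4]
  linarith

theorem flux17 (Y : EuclideanSpace ℝ (Fin n) → Fin n → ℝ)
    (hY : ∀ i, ContDiff ℝ (⊤ : ℕ∞) (fun x => Y x i)) (x₀ : EuclideanSpace ℝ (Fin n))
    (hpos : ∀ x, 0 ≤ ∑ i, Y x i * (x i - x₀ i)) (R : ℝ) (hR : 0 < R) :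
    0 ≤ ∫ x in Metric.ball x₀ R, ∑ i, pd17 (fun y => Y y i) i x := by
  set D : EuclideanSpace ℝ (Fin n) → ℝ := fun x => ∑ i, pd17 (fun y => Y y i) i x with hD
  have hDc : Continuous D := by
    refine continuous_finsetSum _ fun i _ => (pd17_smooth (hY i) i).continuous
  let χ : ℕ → EuclideanSpace ℝ (Fin n) → ℝ :=
    fun m x => Real.smoothTransition (m * (R ^ 2 - ‖x - x₀‖ ^ 2))
  have hχs : ∀ m, ContDiff ℝ (⊤ : ℕ∞) (χ m) := by
    intro m
    refine Real.smoothTransition.contDiff.comp ?_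
    exact contDiff_const.mul (contDiff_const.sub ((contDiff_id.sub contDiff_const).norm_sq ℝ))
  have hχ0 : ∀ m x, x ∉ Metric.ball x₀ R → χ m x = 0 := by
    intro m x hx
    rw [Metric.mem_ball, dist_eq_norm, not_lt] at hx
    apply Real.smoothTransition.zero_of_nonpos
    have : R ^ 2 ≤ ‖x - x₀‖ ^ 2 := by gcongr
    exact mul_nonpos_of_nonneg_of_nonpos (by positivity) (by linarith)
  have hχc : ∀ m, HasCompactSupport (χ m) := fun m =>
    HasCompactSupport.intro (isCompact_closedBall x₀ R)
      (fun x hx => hχ0 m x (fun h => hx (Metric.ball_subset_closedBall h)))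
  have hpd : ∀ m i x, fderiv ℝ (χ m) x (EuclideanSpace.single i 1) =
      - (deriv Real.smoothTransition (m * (R ^ 2 - ‖x - x₀‖ ^ 2)) * m * 2) * (x i - x₀ i) := by
    intro m i x
    have h1 : HasDerivAt Real.smoothTransition
        (deriv Real.smoothTransition (m * (R ^ 2 - ‖x - x₀‖ ^ 2)))
        (m * (R ^ 2 - ‖x - x₀‖ ^ 2)) :=
      ((Real.smoothTransition.contDiff (n := 1)).differentiable (by simp) _).hasDerivAt
    have h2 : HasFDerivAt (fun y : EuclideanSpace ℝ (Fin n) => ‖y - x₀‖ ^ 2) _ x :=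
      ((hasFDerivAt_id x).sub_const x₀).norm_sq
    have h3 := ((h2.const_sub (R ^ 2)).const_mul (m : ℝ))
    have h4 := (h1.comp_hasFDerivAt x h3).fderiv
    change fderiv ℝ (Real.smoothTransition ∘ fun y => (m : ℝ) * (R ^ 2 - ‖y - x₀‖ ^ 2)) x _ = _
    rw [h4]
    simp [EuclideanSpace.inner_single_right]
    ring
  have hbp : ∀ m, 0 ≤ ∫ x, χ m x * D x := by
    intro m
    have hi1 : ∀ i, Integrable (fun x => χ m x * fderiv ℝ (fun y => Y y i) x
        (EuclideanSpace.single i 1)) := fun i =>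
      ((hχs m).continuous.mul (pd17_smooth (hY i) i).continuous).integrable_of_hasCompactSupport
        ((hχc m).mul_right)
    have hi2 : ∀ i, Integrable (fun x => fderiv ℝ (χ m) x (EuclideanSpace.single i 1) * Y x i) :=
      fun i => ((pd17_smooth (hχs m) i).continuous.mul
        (hY i).continuous).integrable_of_hasCompactSupport
        (((hχc m).fderiv_apply ℝ _).mul_right)
    have hi3 : ∀ i, Integrable (fun x => χ m x * Y x i) := fun i =>
      ((hχs m).continuous.mul (hY i).continuous).integrable_of_hasCompactSupport
        ((hχc m).mul_right)
    have e1 : ∫ x, χ m x * D x = ∑ i, ∫ x, χ m x * fderiv ℝ (fun y => Y y i) x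
        (EuclideanSpace.single i 1) := by
      rw [← integral_finsetSum _ (fun i _ => hi1 i)]
      refine integral_congr_ae (Filter.Eventually.of_forall fun x => ?_)
      simp only [hD, Finset.mul_sum]
      rfl
    have e2 : ∀ i, ∫ x, χ m x * fderiv ℝ (fun y => Y y i) x (EuclideanSpace.single i 1) =
        - ∫ x, fderiv ℝ (χ m) x (EuclideanSpace.single i 1) * Y x i := fun i =>
      integral_mul_fderiv_eq_neg_fderiv_mul_of_integrable (hi2 i) (hi1 i) (hi3 i)
        (fun x _ => smooth_diff17 (hχs m) x) (fun x _ => smooth_diff17 (hY i) x)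
    rw [e1]
    simp only [e2]
    rw [Finset.sum_neg_distrib, ← integral_finsetSum _ (fun i _ => hi2 i), ← integral_neg]
    refine integral_nonneg fun x => ?_
    have hd : 0 ≤ deriv Real.smoothTransition (m * (R ^ 2 - ‖x - x₀‖ ^ 2)) :=
      Real.smoothTransition.monotone.deriv_nonneg
    have : -∑ i, fderiv ℝ (χ m) x (EuclideanSpace.single i 1) * Y x i =
        (deriv Real.smoothTransition (m * (R ^ 2 - ‖x - x₀‖ ^ 2)) * m * 2) *
          ∑ i, Y x i * (x i - x₀ i) := by
      rw [Finset.mul_sum, ← Finset.sum_neg_distrib]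
      refine Finset.sum_congr rfl fun i _ => ?_
      rw [hpd]; ring
    simp only [Pi.zero_apply]
    rw [this]
    exact mul_nonneg (by positivity) (hpos x)
  have hlim : Filter.Tendsto (fun m => ∫ x, χ m x * D x) Filter.atTop
      (nhds (∫ x, (Metric.ball x₀ R).indicator D x)) := by
    refine tendsto_integral_of_dominated_convergence
      ((Metric.closedBall x₀ R).indicator fun x => ‖D x‖) (fun m =>
        ((hχs m).continuous.mul hDc).aestronglyMeasurable) ?_ ?_ ?_
    · exact (hDc.norm.continuousOn.integrableOn_compact
        (isCompact_closedBall x₀ R)).integrable_indicator measurableSet_closedBall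
    · refine fun m => Filter.Eventually.of_forall fun x => ?_
      by_cases hx : x ∈ Metric.closedBall x₀ R
      · rw [Set.indicator_of_mem hx, norm_mul]
        have h1 : ‖χ m x‖ ≤ 1 := by
          rw [Real.norm_eq_abs, abs_of_nonneg (Real.smoothTransition.nonneg _)]
          exact Real.smoothTransition.le_one _
        exact mul_le_of_le_one_left (norm_nonneg _) h1
      · rw [Set.indicator_of_notMem hx, hχ0 m x (fun h => hx (Metric.ball_subset_closedBall h))]
        simp
    · refine Filter.Eventually.of_forall fun x => ?_
      by_cases hx : x ∈ Metric.ball x₀ R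
      · rw [Set.indicator_of_mem hx]
        have hx' := hx
        rw [Metric.mem_ball, dist_eq_norm] at hx'
        have hp : 0 < R ^ 2 - ‖x - x₀‖ ^ 2 := by
          have : ‖x - x₀‖ ^ 2 < R ^ 2 := by gcongr
          linarith
        refine tendsto_const_nhds.congr' ?_
        filter_upwards [Filter.eventually_ge_atTop ⌈(R ^ 2 - ‖x - x₀‖ ^ 2)⁻¹⌉₊] with m hm
        have h1 : (R ^ 2 - ‖x - x₀‖ ^ 2)⁻¹ ≤ m := Nat.ceil_le.1 hm
        have h2 : 1 ≤ (m : ℝ) * (R ^ 2 - ‖x - x₀‖ ^ 2) := by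
          rwa [inv_le_iff_one_le_mul₀ hp] at h1
        have h3 : χ m x = 1 := Real.smoothTransition.one_of_one_le h2
        rw [h3, one_mul]
      · rw [Set.indicator_of_notMem hx]
        simp only [hχ0 _ x hx, zero_mul]
        exact tendsto_const_nhds
  rw [← integral_indicator measurableSet_ball]
  exact ge_of_tendsto' hlim hbp

theorem scale17 (g : EuclideanSpace ℝ (Fin n) → ℝ) (x₀ : EuclideanSpace ℝ (Fin n))
    (R : ℝ) (hR : 0 < R) :
    ∫ x in Metric.ball x₀ R, g x = R ^ n * ∫ y in Metric.ball 0 1, g (x₀ + R • y) := by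
  have h := Measure.setIntegral_comp_smul_of_pos (volume : Measure (EuclideanSpace ℝ (Fin n)))
    (fun y => g (x₀ + y)) (Metric.ball 0 1) hR
  rw [h, smul_unitBall_of_pos hR, finrank_euclideanSpace, Fintype.card_fin, smul_eq_mul,
    ← mul_assoc, mul_inv_cancel₀ (by positivity), one_mul]
  have hp := measurePreserving_add_left (volume : Measure (EuclideanSpace ℝ (Fin n))) x₀
  have h2 := hp.setIntegral_preimage_emb (measurableEmbedding_addLeft x₀) g (Metric.ball x₀ R)
  rw [← h2]
  congr 2
  ext y
  simp [Metric.mem_ball, dist_eq_norm]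

theorem deriv_scale17 {g : EuclideanSpace ℝ (Fin n) → ℝ} (hg : ContDiff ℝ (⊤ : ℕ∞) g)
    (x₀ : EuclideanSpace ℝ (Fin n)) (R : ℝ) :
    HasDerivAt (fun r : ℝ => ∫ y in Metric.ball (0 : EuclideanSpace ℝ (Fin n)) 1, g (x₀ + r • y))
      (∫ y in Metric.ball (0 : EuclideanSpace ℝ (Fin n)) 1, fderiv ℝ g (x₀ + R • y) y) R := by
  have hfc : Continuous (fderiv ℝ g) := hg.continuous_fderiv (by simp)
  have hc2 : Continuous (fun p : ℝ × EuclideanSpace ℝ (Fin n) =>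
      fderiv ℝ g (x₀ + p.1 • p.2) p.2) :=
    (hfc.comp (by fun_prop)).clm_apply continuous_snd
  obtain ⟨C, hC⟩ := ((isCompact_closedBall R 1).prod (isCompact_closedBall
    (0 : EuclideanSpace ℝ (Fin n)) 1)).exists_bound_of_continuousOn hc2.continuousOn
  have hfin : volume (Metric.ball (0 : EuclideanSpace ℝ (Fin n)) 1) ≠ ⊤ :=
    measure_ball_lt_top.ne
  have hgc : ∀ r : ℝ, Continuous (fun y => g (x₀ + r • y)) := fun r =>
    hg.continuous.comp (by fun_prop)
  refine (hasDerivAt_integral_of_dominated_loc_of_deriv_le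
    (F' := fun r y => fderiv ℝ g (x₀ + r • y) y) (bound := fun _ => C)
    (Metric.ball_mem_nhds R one_pos) ?_ ?_ ?_ ?_ ?_ ?_).2
  · exact Filter.Eventually.of_forall fun r => (hgc r).aestronglyMeasurable
  · exact ((hgc R).continuousOn.integrableOn_compact
      (isCompact_closedBall 0 1)).mono_set Metric.ball_subset_closedBall
  · exact (hc2.comp (by fun_prop : Continuous fun y : EuclideanSpace ℝ (Fin n) =>
      (R, y))).aestronglyMeasurable
  · refine (ae_restrict_iff' measurableSet_ball).2 (Filter.Eventually.of_forall
      fun y hy r hr => hC (r, y) ⟨Metric.ball_subset_closedBall hr,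
        Metric.ball_subset_closedBall hy⟩)
  · exact integrableOn_const hfin
  · refine Filter.Eventually.of_forall fun y r _ => ?_
    have h1 : HasDerivAt (fun r : ℝ => x₀ + r • y) y r := by
      simpa using ((hasDerivAt_id r).smul_const y).const_add x₀
    exact (smooth_diff17 hg _).hasFDerivAt.comp_hasDerivAt r h1

theorem mono17 {e : EuclideanSpace ℝ (Fin n) → ℝ} (he : ContDiff ℝ (⊤ : ℕ∞) e)
    (Y : EuclideanSpace ℝ (Fin n) → Fin n → ℝ)
    (hY : ∀ i, ContDiff ℝ (⊤ : ℕ∞) (fun x => Y x i)) (x₀ : EuclideanSpace ℝ (Fin n))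
    (hpos : ∀ x, 0 ≤ ∑ i, Y x i * (x i - x₀ i))
    (hdiv : ∀ x, ∑ i, pd17 (fun y => Y y i) i x ≤ 4 * e x + fderiv ℝ e x (x - x₀)) :
    MonotoneOn (fun R : ℝ => R ^ ((4:ℝ) - n) * ∫ x in Metric.ball x₀ R, e x) (Ioi 0) := by
  set I : ℝ → ℝ := fun r => ∫ y in Metric.ball (0 : EuclideanSpace ℝ (Fin n)) 1, e (x₀ + r • y)
    with hI
  have hfc : Continuous (fderiv ℝ e) := he.continuous_fderiv (by simp)
  have heq : ∀ R ∈ Ioi (0:ℝ), R ^ 4 * I R = R ^ ((4:ℝ) - n) * ∫ x in Metric.ball x₀ R, e x := by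
    intro R hR
    have hR' : (0:ℝ) < R := hR
    rw [scale17 e x₀ R hR', ← mul_assoc, ← Real.rpow_natCast R n, ← Real.rpow_add hR']
    simp only [sub_add_cancel]
    norm_cast
  refine MonotoneOn.congr ?_ heq
  have hder : ∀ R, HasDerivAt (fun r => r ^ 4 * I r) (4 * R ^ 3 * I R + R ^ 4 *
      ∫ y in Metric.ball (0 : EuclideanSpace ℝ (Fin n)) 1, fderiv ℝ e (x₀ + R • y) y) R := by
    intro R
    have := (hasDerivAt_pow 4 R).mul (deriv_scale17 he x₀ R)
    refine HasDerivAt.congr_deriv this ?_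
    simp [hI]
  refine monotoneOn_of_deriv_nonneg (convex_Ioi 0)
    (fun R _ => (hder R).continuousAt.continuousWithinAt)
    (fun R _ => (hder R).differentiableAt.differentiableWithinAt) ?_
  intro R hR
  rw [interior_Ioi] at hR
  have hR' : (0:ℝ) < R := hR
  rw [(hder R).deriv]
  have hint : ∀ {f : EuclideanSpace ℝ (Fin n) → ℝ}, Continuous f → ∀ (c : EuclideanSpace ℝ (Fin n))
      (r : ℝ), IntegrableOn f (Metric.ball c r) := fun hf c r =>
    (hf.continuousOn.integrableOn_compact (isCompact_closedBall c r)).mono_set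
      Metric.ball_subset_closedBall
  have hgc : Continuous (fun x => 4 * e x + fderiv ℝ e x (x - x₀)) :=
    (continuous_const.mul he.continuous).add (hfc.clm_apply (by fun_prop))
  have hDc : Continuous (fun x => ∑ i, pd17 (fun y => Y y i) i x) :=
    continuous_finsetSum _ fun i _ => (pd17_smooth (hY i) i).continuous
  have h0 : 0 ≤ ∫ x in Metric.ball x₀ R, (4 * e x + fderiv ℝ e x (x - x₀)) :=
    (flux17 Y hY x₀ hpos R hR').trans
      (setIntegral_mono (hint hDc _ _) (hint hgc _ _) hdiv)
  rw [scale17 _ x₀ R hR'] at h0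
  have h1 := nonneg_of_mul_nonneg_right h0 (by positivity)
  have h2 : ∫ y in Metric.ball (0 : EuclideanSpace ℝ (Fin n)) 1,
      (4 * e (x₀ + R • y) + fderiv ℝ e (x₀ + R • y) (x₀ + R • y - x₀)) =
      4 * I R + R * ∫ y in Metric.ball (0 : EuclideanSpace ℝ (Fin n)) 1,
        fderiv ℝ e (x₀ + R • y) y := by
    rw [hI, ← integral_const_mul, ← integral_const_mul, ← integral_add]
    · refine integral_congr_ae (Filter.Eventually.of_forall fun y => ?_)
      simp
    · exact hint (continuous_const.mul (he.continuous.comp (by fun_prop))) _ _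
    · exact hint (continuous_const.mul
        ((hfc.comp (by fun_prop)).clm_apply continuous_id)) _ _
  rw [h2] at h1
  have : 4 * R ^ 3 * I R + R ^ 4 * ∫ y in Metric.ball (0 : EuclideanSpace ℝ (Fin n)) 1,
      fderiv ℝ e (x₀ + R • y) y = R ^ 3 * (4 * I R + R *
      ∫ y in Metric.ball (0 : EuclideanSpace ℝ (Fin n)) 1, fderiv ℝ e (x₀ + R • y) y) := by ring
  rw [this]
  exact mul_nonneg (by positivity) h1

theorem S_psd17 (br : G →ₗ[ℝ] G →ₗ[ℝ] G) (ρ : G →ₗ[ℝ] V →ₗ[ℝ] V)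
    (A : EuclideanSpace ℝ (Fin n) → Fin n → G) (u : EuclideanSpace ℝ (Fin n) → V)
    (x : EuclideanSpace ℝ (Fin n)) (v : Fin n → ℝ) :
    0 ≤ ∑ i, (∑ j, S17 br ρ A u x i j * v j) * v i := by
  have h : ∑ i, (∑ j, S17 br ρ A u x i j * v j) * v i =
      ∑ k, ⟪∑ i, v i • curv17 br A x i k, ∑ j, v j • curv17 br A x j k⟫
      + ⟪∑ i, v i • covD17 ρ A u x i, ∑ j, v j • covD17 ρ A u x j⟫ := by
    simp only [sum_inner, inner_sum, real_inner_smul_left, real_inner_smul_right]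
    rw [Finset.sum_comm, ← Finset.sum_add_distrib]
    refine Finset.sum_congr rfl fun i _ => ?_
    rw [Finset.sum_comm, ← Finset.sum_add_distrib, Finset.sum_mul]
    refine Finset.sum_congr rfl fun j _ => ?_
    unfold S17
    rw [add_mul, add_mul, Finset.sum_mul, Finset.sum_mul]
    congr 1
    · refine Finset.sum_congr rfl fun k _ => ?_
      rw [real_inner_comm]; ring
    · rw [real_inner_comm]; ring
  rw [h]
  exact add_nonneg (Finset.sum_nonneg fun k _ => real_inner_self_nonneg) real_inner_self_nonneg

theorem fderiv_expand17 {F : Type*} [NormedAddCommGroup F] [NormedSpace ℝ F]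
    (f : EuclideanSpace ℝ (Fin n) → F) (x v : EuclideanSpace ℝ (Fin n)) :
    fderiv ℝ f x v = ∑ j, v j • pd17 f j x := by
  have hv : v = ∑ j, v j • EuclideanSpace.single j (1:ℝ) := by
    have := (EuclideanSpace.basisFun (Fin n) ℝ).sum_repr v
    simpa using this.symm
  conv_lhs => rw [hv]
  simp [pd17]

/-- monotonicity for Yang–Mills–Higgs pairs on `ℝⁿ` (`n > 4`), for a
trivial principal bundle with compact semisimple structure group encoded by its Lie
algebra `𝔤 = G` (bracket `br`, inner product minus the Killing form, hence invariant)
and a representation `ρ` on `V` with invariant inner product: if `(A, u)` solves the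
Yang–Mills–Higgs equations with `W ≥ 0`, then
`R ↦ R^{4−n} ∫_{B_R(x₀)} (½|F_A|² + ½|d^∇u|² + W(|u|²))` is non-decreasing on `(0,∞)`. -/
theorem stmt_17 (hn : 4 < n)
    (br : G →ₗ[ℝ] G →ₗ[ℝ] G) (ρ : G →ₗ[ℝ] V →ₗ[ℝ] V)
    (hbr_skew : ∀ X Y : G, br X Y = -br Y X)
    (hjacobi : ∀ X Y Z : G, br X (br Y Z) = br (br X Y) Z + br Y (br X Z))
    (hbr_inv : ∀ X Y Z : G, ⟪br X Y, Z⟫ = -⟪Y, br X Z⟫)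
    (hρ_lie : ∀ X Y : G, ∀ v : V, ρ (br X Y) v = ρ X (ρ Y v) - ρ Y (ρ X v))
    (hρ_skew : ∀ (X : G) (v w : V), ⟪ρ X v, w⟫ = -⟪v, ρ X w⟫)
    (A : EuclideanSpace ℝ (Fin n) → Fin n → G) (u : EuclideanSpace ℝ (Fin n) → V)
    (W : ℝ → ℝ) (hA : ∀ i, ContDiff ℝ (⊤ : ℕ∞) (fun x => A x i)) (hu : ContDiff ℝ (⊤ : ℕ∞) u)
    (hW : ContDiff ℝ (⊤ : ℕ∞) W) (hWpos : ∀ t, 0 ≤ W t)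
    (h1 : YMH1 br ρ A u) (h2 : YMH2 ρ A u W)
    (x₀ : EuclideanSpace ℝ (Fin n)) :
    MonotoneOn
      (fun R : ℝ => R ^ ((4:ℝ) - n) * ∫ x in Metric.ball x₀ R, eYMH17 br ρ A u W x)
      (Ioi 0) := by
  have hc : ∀ j, ContDiff ℝ (⊤ : ℕ∞) (fun x : EuclideanSpace ℝ (Fin n) => x j - x₀ j) :=
    fun j => by fun_prop
  have hpc : ∀ (j i : Fin n) (x : EuclideanSpace ℝ (Fin n)),
      pd17 (fun x : EuclideanSpace ℝ (Fin n) => x j - x₀ j) i x = if j = i then 1 else 0 := by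
    intro j i x
    unfold pd17
    rw [fderiv_sub_const]
    have h : HasFDerivAt (fun y : EuclideanSpace ℝ (Fin n) => y j)
      (EuclideanSpace.proj j : EuclideanSpace ℝ (Fin n) →L[ℝ] ℝ) x :=
      (EuclideanSpace.proj j : EuclideanSpace ℝ (Fin n) →L[ℝ] ℝ).hasFDerivAt
    rw [h.fderiv]
    simp [Pi.single_apply]
  refine mono17 (e_smooth17 br ρ hA hu hW)
    (fun x i => ∑ j, S17 br ρ A u x i j * (x j - x₀ j))
    (fun i => ContDiff.sum fun j _ => (S_smooth17 br ρ hA hu i j).mul (hc j)) x₀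
    (fun x => S_psd17 br ρ A u x (fun j => x j - x₀ j)) ?_
  intro x
  have hd : ∀ i, pd17 (fun y => ∑ j, S17 br ρ A u y i j * (y j - x₀ j)) i x =
      ∑ j, pd17 (fun y => S17 br ρ A u y i j) i x * (x j - x₀ j) + S17 br ρ A u x i i := by
    intro i
    rw [pd17_sum (fun j => (S_smooth17 br ρ hA hu i j).mul (hc j))]
    simp only [pd17_mul (S_smooth17 br ρ hA hu i _) (hc _), hpc, Finset.sum_add_distrib]
    simp
  simp only [hd, Finset.sum_add_distrib]
  rw [Finset.sum_comm]
  simp only [← Finset.sum_mul, div_S17 br ρ hbr_skew hjacobi hbr_inv hρ_lie hρ_skew hA hu hW h1 h2]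
  rw [fderiv_expand17]
  have e1 : ∑ j, (x - x₀) j • pd17 (eYMH17 br ρ A u W) j x =
      ∑ j, pd17 (eYMH17 br ρ A u W) j x * (x j - x₀ j) := by
    refine Finset.sum_congr rfl fun j _ => ?_
    simp [mul_comm]
  have e2 : ∑ i, S17 br ρ A u x i i = ∑ i, ∑ k, ‖curv17 br A x i k‖ ^ 2 +
      ∑ i, ‖covD17 ρ A u x i‖ ^ 2 := by
    simp only [S17, real_inner_self_eq_norm_sq, Finset.sum_add_distrib]
  have e3 : 0 ≤ ∑ i, ‖covD17 ρ A u x i‖ ^ 2 := Finset.sum_nonneg fun i _ => by positivity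
  have e4 := hWpos (‖u x‖ ^ 2)
  rw [e1, e2]
  unfold eYMH17
  linarith

end YMH

end
end
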